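/- arXiv:1009.4305 — 9 statements merged into one kernel-verified Lean document; each statement's English description precedes it below -/
import Mathlib

section
/- Every minimizer of F has the predicted structure: if ρ = u·ℒ¹ + ρ⊥ is a finite nonnegative Borel measure on ℝ with ρ(ℝ) = m, F(ρ) finite, and F(ρ) ≤ F(σ) for every finite nonnegative Borel measure σ with σ(ℝ) = m, then u(x) = H(V(x) − 𝔳) for ℒ¹-a.e. x ∈ ℝ, ρ⊥ is concentrated on Q, and ρ⊥(ℝ) = (m − m_c)⁺; in particular, if m < m_c then ρ⊥ = 0. -/
open MeasureTheory Set Filter Topology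
open scoped ENNReal

noncomputable def Edens (β : ℝ → ℝ) (r : ℝ) : ℝ :=
  -β r - r * ∫ s in Set.Ioi r, deriv β s / s

noncomputable def erealInt (f : ℝ → ℝ) (μ : Measure ℝ) : EReal :=
  ((∫⁻ x, ENNReal.ofReal (f x) ∂μ : ℝ≥0∞) : EReal)
    - ((∫⁻ x, ENNReal.ofReal (-(f x)) ∂μ : ℝ≥0∞) : EReal)

noncomputable def Fent (β V : ℝ → ℝ) (ρ : Measure ℝ) : EReal :=
  if (∫⁻ x, ENNReal.ofReal (V x) ∂ρ) = ⊤ then ⊤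
  else
    (-(((∫⁻ x, ENNReal.ofReal (-(Edens β ((ρ.rnDeriv volume x).toReal)))) : ℝ≥0∞) : EReal))
      + erealInt V ρ

/-- `𝔡 = ∫_0^∞ β'(s)/s ds ∈ (0,+∞]`. -/
noncomputable def dcrit (β : ℝ → ℝ) : ℝ≥0∞ :=
  ∫⁻ s in Set.Ioi (0 : ℝ), ENNReal.ofReal (deriv β s / s)

/-- The critical mass `m_c = ∫_ℝ H(V(x) - V_min) dx ∈ (0,+∞]`
(here `H` is the `[0,+∞]`-valued pseudo-inverse of `-E'`). -/
noncomputable def mcrit (H : ℝ → ℝ≥0∞) (V : ℝ → ℝ) (Vmin : ℝ) : ℝ≥0∞ :=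
  ∫⁻ x, H (V x - Vmin)

section facts
variable {β : ℝ → ℝ} {βinf : ℝ}

lemma bderiv_nonneg (hβmono : StrictMonoOn β (Set.Ici 0)) {s : ℝ} (hs : 0 < s) :
    0 ≤ deriv β s := by
  have h := hβmono.monotoneOn.derivWithin_nonneg (x := s)
  rwa [derivWithin_of_mem_nhds (Ici_mem_nhds hs)] at h

lemma bquot_int (hβ : ContDiff ℝ 1 β) (hβmono : StrictMonoOn β (Set.Ici 0))
    (hβlim : Tendsto β atTop (𝓝 βinf)) {a : ℝ} (ha : 0 < a) :
    IntegrableOn (fun s => deriv β s / s) (Set.Ioi a) := by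
  have h1 : IntegrableOn (deriv β) (Set.Ioi a) := by
    refine integrableOn_Ioi_deriv_of_nonneg' (g := β) (l := βinf) ?_ ?_ hβlim
    · intro x _
      exact (hβ.differentiable one_ne_zero x).hasDerivAt
    · intro x hx
      exact bderiv_nonneg hβmono (ha.trans hx)
  refine Integrable.mono' (h1.div_const a) ?_ ?_
  · have hm : Measurable (fun s => deriv β s / s) := (measurable_deriv β).div measurable_id
    exact hm.aestronglyMeasurable
  · refine (ae_restrict_iff' measurableSet_Ioi).2 (Eventually.of_forall fun s hs => ?_)
    have hs' : a < s := hs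
    have h0 := bderiv_nonneg hβmono (ha.trans hs')
    rw [Real.norm_of_nonneg (div_nonneg h0 (ha.trans hs').le)]
    gcongr

lemma G_key (hβ : ContDiff ℝ 1 β) (hβmono : StrictMonoOn β (Set.Ici 0))
    (hβlim : Tendsto β atTop (𝓝 βinf)) {a b : ℝ} (ha : 0 < a) (hab : a < b) :
    a * ((∫ s in Set.Ioi a, deriv β s / s) - ∫ s in Set.Ioi b, deriv β s / s) < β b - β a ∧
    β b - β a < b * ((∫ s in Set.Ioi a, deriv β s / s) - ∫ s in Set.Ioi b, deriv β s / s) := by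
  have hc : Continuous (deriv β) := hβ.continuous_deriv le_rfl
  have hd : ∀ x, HasDerivAt β (deriv β x) x :=
    fun x => (hβ.differentiable one_ne_zero x).hasDerivAt
  have e1 : (∫ s in Set.Ioi a, deriv β s / s) - ∫ s in Set.Ioi b, deriv β s / s
      = ∫ s in a..b, deriv β s / s := by
    have := intervalIntegral.integral_interval_add_Ioi (bquot_int hβ hβmono hβlim ha)
      (bquot_int hβ hβmono hβlim (ha.trans hab))
    linarith
  have e2 : ∫ s in a..b, deriv β s = β b - β a :=
    intervalIntegral.integral_eq_sub_of_hasDerivAt (fun x _ => hd x) (hc.intervalIntegrable _ _)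
  obtain ⟨c, hcI, hcs⟩ := exists_deriv_eq_slope β hab hβ.continuous.continuousOn
    (hβ.differentiable one_ne_zero).differentiableOn
  have hcpos : 0 < deriv β c := by
    rw [hcs]
    exact div_pos (sub_pos.2 (hβmono ha.le (ha.trans hab).le hab)) (sub_pos.2 hab)
  have hc0 : 0 < c := ha.trans hcI.1
  have hq : ContinuousOn (fun s => deriv β s / s) (Icc a b) :=
    hc.continuousOn.div continuousOn_id (fun x hx => (ha.trans_le hx.1).ne')
  rw [e1, ← e2, ← intervalIntegral.integral_const_mul, ← intervalIntegral.integral_const_mul]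
  constructor
  · refine intervalIntegral.integral_lt_integral_of_continuousOn_of_le_of_exists_lt hab
      (continuousOn_const.mul hq) hc.continuousOn ?_ ⟨c, ⟨hcI.1.le, hcI.2.le⟩, ?_⟩
    · intro x hx
      have hx0 : 0 < x := ha.trans hx.1
      have := bderiv_nonneg hβmono hx0
      rw [mul_div_assoc', div_le_iff₀ hx0]
      nlinarith [hx.1]
    · rw [mul_div_assoc', div_lt_iff₀ hc0]
      nlinarith [hcI.1]
  · refine intervalIntegral.integral_lt_integral_of_continuousOn_of_le_of_exists_lt hab
      hc.continuousOn (continuousOn_const.mul hq) ?_ ⟨c, ⟨hcI.1.le, hcI.2.le⟩, ?_⟩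
    · intro x hx
      have hx0 : 0 < x := ha.trans hx.1
      have := bderiv_nonneg hβmono hx0
      rw [mul_div_assoc', le_div_iff₀ hx0]
      nlinarith [hx.2]
    · rw [mul_div_assoc', lt_div_iff₀ hc0]
      nlinarith [hcI.2]

lemma G_nonneg (hβmono : StrictMonoOn β (Set.Ici 0)) {a : ℝ} (ha : 0 ≤ a) :
    0 ≤ ∫ s in Set.Ioi a, deriv β s / s :=
  setIntegral_nonneg measurableSet_Ioi fun s hs =>
    div_nonneg (bderiv_nonneg hβmono (ha.trans_lt hs)) (ha.trans hs.le)

lemma G_le_d (hβ : ContDiff ℝ 1 β) (hβmono : StrictMonoOn β (Set.Ici 0))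
    (hβlim : Tendsto β atTop (𝓝 βinf)) {a : ℝ} (ha : 0 < a) :
    ENNReal.ofReal (∫ s in Set.Ioi a, deriv β s / s) ≤ dcrit β := by
  rw [ofReal_integral_eq_lintegral_ofReal (bquot_int hβ hβmono hβlim ha)]
  · exact lintegral_mono_set (Ioi_subset_Ioi ha.le)
  · refine (ae_restrict_iff' measurableSet_Ioi).2 (Eventually.of_forall fun s hs => ?_)
    exact div_nonneg (bderiv_nonneg hβmono (ha.trans hs)) (ha.trans hs).le

lemma b_nonneg (hβmono : StrictMonoOn β (Set.Ici 0)) (hβ0 : β 0 = 0) {a : ℝ} (ha : 0 ≤ a) :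
    0 ≤ β a := by
  rw [← hβ0]; exact hβmono.monotoneOn (mem_Ici.2 le_rfl) ha ha

lemma E_nonpos (hβmono : StrictMonoOn β (Set.Ici 0)) (hβ0 : β 0 = 0) {a : ℝ} (ha : 0 ≤ a) :
    Edens β a ≤ 0 := by
  have := b_nonneg hβmono hβ0 ha
  have := mul_nonneg ha (G_nonneg hβmono ha)
  unfold Edens
  linarith

lemma b_le_lin (hβ : ContDiff ℝ 1 β) (hβmono : StrictMonoOn β (Set.Ici 0)) (hβ0 : β 0 = 0)
    (hβlim : Tendsto β atTop (𝓝 βinf)) : ∃ C : ℝ, ∀ r : ℝ, 0 ≤ r → β r ≤ C * r := by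
  have hc : Continuous (deriv β) := hβ.continuous_deriv le_rfl
  obtain ⟨M, hM⟩ := (isCompact_Icc (a := (0:ℝ)) (b := 1)).exists_bound_of_continuousOn
    hc.continuousOn
  refine ⟨max M βinf, fun r hr => ?_⟩
  rcases le_total r 1 with h | h
  · have := (convex_Icc (0:ℝ) 1).norm_image_sub_le_of_norm_deriv_le
      (f := β) (C := M) (x := 0) (y := r) (fun x _ => hβ.differentiable one_ne_zero x) hM
      ⟨le_rfl, zero_le_one⟩ ⟨hr, h⟩
    rw [hβ0, sub_zero, sub_zero, Real.norm_of_nonneg hr] at this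
    calc β r ≤ ‖β r‖ := Real.le_norm_self _
      _ ≤ M * r := this
      _ ≤ _ := by gcongr; exact le_max_left _ _
  · have h1 : β r ≤ βinf := by
      refine ge_of_tendsto hβlim ?_
      filter_upwards [eventually_ge_atTop r] with x hx
      exact hβmono.monotoneOn hr (hr.trans hx) hx
    have h2 : 0 ≤ βinf := (b_nonneg hβmono hβ0 hr).trans h1
    calc β r ≤ βinf := h1
      _ ≤ βinf * r := by nlinarith
      _ ≤ _ := by gcongr; exact le_max_right _ _

/-- the pointwise (Young type) inequality -/
lemma pointwise (hβ : ContDiff ℝ 1 β) (hβmono : StrictMonoOn β (Set.Ici 0)) (hβ0 : β 0 = 0)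
    (hβlim : Tendsto β atTop (𝓝 βinf)) {H : ℝ → ℝ≥0∞}
    (hH1 : ∀ v : ℝ, 0 < v → ENNReal.ofReal v < dcrit β →
      H v ≠ 0 ∧ H v ≠ ⊤ ∧ (∫ s in Set.Ioi ((H v).toReal), deriv β s / s) = v)
    (hH2 : ∀ v : ℝ, dcrit β ≤ ENNReal.ofReal v → H v = 0) {w : ℝ} (hw : 0 < w) :
    Edens β (H w).toReal + w * (H w).toReal = - β (H w).toReal ∧
    ∀ r : ℝ, 0 ≤ r → r ≠ (H w).toReal → - β (H w).toReal < Edens β r + w * r := by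
  rcases lt_or_ge (ENNReal.ofReal w) (dcrit β) with h | h
  · obtain ⟨h1, h2, h3⟩ := hH1 w hw h
    set a := (H w).toReal with ha
    have ha0 : 0 < a := ENNReal.toReal_pos h1 h2
    constructor
    · unfold Edens; rw [h3]; ring
    · intro r hr hne
      unfold Edens
      rcases hr.eq_or_lt with rfl | hr0
      · have := hβmono (mem_Ici.2 le_rfl) ha0.le ha0
        simp only [hβ0] at *
        linarith
      rcases lt_or_gt_of_ne hne with h | h
      · have := (G_key hβ hβmono hβlim hr0 h).1
        rw [h3] at this
        linarith
      · have := (G_key hβ hβmono hβlim ha0 h).2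
        rw [h3] at this
        linarith
  · have h0 := hH2 w h
    rw [h0]
    have hGw : ∀ a, 0 < a → (∫ s in Set.Ioi a, deriv β s / s) ≤ w := fun a ha =>
      (ENNReal.ofReal_le_ofReal_iff hw.le).1 ((G_le_d hβ hβmono hβlim ha).trans h)
    have key : ∀ r, 0 < r → β r ≤ r * (w - ∫ s in Set.Ioi r, deriv β s / s) := by
      intro r hr
      have ht : Tendsto (fun a => β r - β a) (𝓝[>] 0) (𝓝 (β r - β 0)) :=
        (tendsto_const_nhds.sub hβ.continuous.continuousAt.tendsto).mono_left nhdsWithin_le_nhds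
      rw [hβ0, sub_zero] at ht
      refine le_of_tendsto ht ?_
      filter_upwards [Ioo_mem_nhdsGT hr] with a ha
      refine (G_key hβ hβmono hβlim ha.1 ha.2).2.le.trans ?_
      have := hGw a ha.1
      gcongr
    constructor
    · simp [Edens, hβ0]
    · intro r hr hne
      simp only [ENNReal.toReal_zero, hβ0] at hne ⊢
      have hr0 : 0 < r := lt_of_le_of_ne hr (Ne.symm hne)
      have k1 := key (r / 2) (by positivity)
      have k2 := (G_key hβ hβmono hβlim (half_pos hr0) (half_lt_self hr0)).2
      have k3 := hGw (r/2) (by positivity)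
      unfold Edens
      nlinarith

lemma H_antitone (hβ : ContDiff ℝ 1 β) (hβmono : StrictMonoOn β (Set.Ici 0))
    (hβlim : Tendsto β atTop (𝓝 βinf)) {H : ℝ → ℝ≥0∞}
    (hH1 : ∀ v : ℝ, 0 < v → ENNReal.ofReal v < dcrit β →
      H v ≠ 0 ∧ H v ≠ ⊤ ∧ (∫ s in Set.Ioi ((H v).toReal), deriv β s / s) = v)
    (hH2 : ∀ v : ℝ, dcrit β ≤ ENNReal.ofReal v → H v = 0)
    (hH3 : ∀ v : ℝ, v ≤ 0 → H v = ⊤) : Antitone H := by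
  intro v w hvw
  rcases le_or_gt v 0 with h | hv
  · rw [hH3 v h]; exact le_top
  rcases le_or_gt (dcrit β) (ENNReal.ofReal w) with h | hw
  · rw [hH2 w h]; exact bot_le
  obtain ⟨a1, a2, a3⟩ := hH1 w (hv.trans_le hvw) hw
  obtain ⟨b1, b2, b3⟩ := hH1 v hv ((ENNReal.ofReal_le_ofReal hvw).trans_lt hw)
  by_contra! hlt
  have h1 : (H v).toReal < (H w).toReal := (ENNReal.toReal_lt_toReal b2 a2).2 hlt
  have hp : 0 < (H v).toReal := ENNReal.toReal_pos b1 b2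
  have k := G_key hβ hβmono hβlim hp h1
  rw [a3, b3] at k
  have := k.1.trans k.2
  nlinarith
end facts

section fent
variable {β : ℝ → ℝ} {βinf : ℝ}

lemma E_measurable (hβ : ContDiff ℝ 1 β) : Measurable (Edens β) := by
  have h1 : StronglyMeasurable (fun r : ℝ => ∫ s in Set.Ioi r, deriv β s / s) := by
    have e : (fun r : ℝ => ∫ s in Set.Ioi r, deriv β s / s)
        = fun r : ℝ => ∫ s, Set.indicator {p : ℝ × ℝ | p.1 < p.2}
            (fun p => deriv β p.2 / p.2) (r, s) := by
      funext r
      rw [← integral_indicator measurableSet_Ioi]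
      rfl
    rw [e]
    refine StronglyMeasurable.integral_prod_right' (f := Set.indicator {p : ℝ × ℝ | p.1 < p.2}
            (fun p => deriv β p.2 / p.2)) ?_
    refine StronglyMeasurable.indicator ?_ (measurableSet_lt measurable_fst measurable_snd)
    have : Measurable (fun p : ℝ × ℝ => deriv β p.2 / p.2) :=
      ((measurable_deriv β).comp measurable_snd).div measurable_snd
    exact this.stronglyMeasurable
  exact hβ.continuous.measurable.neg.sub (measurable_id.mul h1.measurable)

lemma ofReal_lint_ne_top {f : ℝ → ℝ} {μ : Measure ℝ} (hf : Integrable f μ) :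
    ∫⁻ x, ENNReal.ofReal (f x) ∂μ ≠ ⊤ := by
  refine ne_top_of_le_ne_top hf.2.ne (lintegral_mono fun x => ?_)
  exact Real.ofReal_le_enorm (f x)

lemma erealInt_eq {f : ℝ → ℝ} {μ : Measure ℝ} (hf : Integrable f μ) :
    erealInt f μ = ((∫ x, f x ∂μ : ℝ) : EReal) := by
  have h1 := ofReal_lint_ne_top hf
  have h2 : ∫⁻ x, ENNReal.ofReal (-f x) ∂μ ≠ ⊤ := ofReal_lint_ne_top hf.neg
  rw [integral_eq_lintegral_pos_part_sub_lintegral_neg_part hf, erealInt, EReal.coe_sub,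
    EReal.coe_ennreal_toReal h1, EReal.coe_ennreal_toReal h2]

lemma Fent_eq (hβmono : StrictMonoOn β (Set.Ici 0)) (hβ0 : β 0 = 0)
    {V : ℝ → ℝ} {σ : Measure ℝ} (hVi : Integrable V σ)
    (hEi : Integrable (fun x => Edens β ((σ.rnDeriv volume x).toReal))) :
    Fent β V σ = (((∫ x, Edens β ((σ.rnDeriv volume x).toReal)) + ∫ x, V x ∂σ : ℝ) : EReal) := by
  unfold Fent
  rw [if_neg (ofReal_lint_ne_top hVi), erealInt_eq hVi, EReal.coe_add]
  congr 1
  have h0 : 0 ≤ᵐ[volume] fun x => -Edens β ((σ.rnDeriv volume x).toReal) :=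
    Eventually.of_forall fun x => neg_nonneg.2 (E_nonpos hβmono hβ0 ENNReal.toReal_nonneg)
  have := ofReal_integral_eq_lintegral_ofReal hEi.neg h0
  simp only [Pi.neg_apply] at this
  rw [← this, EReal.coe_ennreal_ofReal, max_eq_left (integral_nonneg_of_ae h0), integral_neg]
  rw [← EReal.coe_neg, neg_neg]

lemma Fent_int (hβ : ContDiff ℝ 1 β) (hβmono : StrictMonoOn β (Set.Ici 0)) (hβ0 : β 0 = 0)
    {V : ℝ → ℝ} (hV : Continuous V) {Vmin : ℝ} (hVmin : ∀ x, Vmin ≤ V x)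
    {σ : Measure ℝ} [IsFiniteMeasure σ] (h1 : Fent β V σ ≠ ⊤) (h2 : Fent β V σ ≠ ⊥) :
    Integrable V σ ∧ Integrable (fun x => Edens β ((σ.rnDeriv volume x).toReal)) := by
  have hp : (∫⁻ x, ENNReal.ofReal (V x) ∂σ) ≠ ⊤ := by
    intro h
    exact h1 (by rw [Fent, if_pos h])
  have hn : (∫⁻ x, ENNReal.ofReal (- V x) ∂σ) ≠ ⊤ := by
    refine ne_top_of_le_ne_top ?_ (lintegral_mono (g := fun _ => ENNReal.ofReal (-Vmin))
      fun x => ENNReal.ofReal_le_ofReal (neg_le_neg (hVmin x)))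
    rw [lintegral_const]
    exact ENNReal.mul_ne_top ENNReal.ofReal_ne_top (measure_ne_top _ _)
  have hVi : Integrable V σ := by
    refine ⟨hV.aestronglyMeasurable, ?_⟩
    refine lt_of_le_of_lt (lintegral_mono (g := fun x => ENNReal.ofReal (V x) + ENNReal.ofReal (- V x))
      fun x => ?_) ?_
    · simp only [← ofReal_norm, Real.norm_eq_abs]
      rcases le_total 0 (V x) with h | h
      · rw [abs_of_nonneg h]; exact le_self_add
      · rw [abs_of_nonpos h]; exact le_add_self
    · rw [lintegral_add_left hV.measurable.ennreal_ofReal]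
      exact ENNReal.add_lt_top.2 ⟨hp.lt_top, hn.lt_top⟩
  refine ⟨hVi, ?_⟩
  have hm : Measurable (fun x => Edens β ((σ.rnDeriv volume x).toReal)) :=
    (E_measurable hβ).comp (Measure.measurable_rnDeriv σ volume).ennreal_toReal
  refine ⟨hm.aestronglyMeasurable, ?_⟩
  have : ∀ x, ‖Edens β ((σ.rnDeriv volume x).toReal)‖ₑ
      = ENNReal.ofReal (-Edens β ((σ.rnDeriv volume x).toReal)) := by
    intro x
    rw [← ofReal_norm, Real.norm_eq_abs,
      abs_of_nonpos (E_nonpos hβmono hβ0 ENNReal.toReal_nonneg)]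
  unfold HasFiniteIntegral
  simp only [this]
  rw [lt_top_iff_ne_top]
  intro h
  apply h2
  rw [Fent, if_neg hp, h]
  simp

lemma Fent_repr (hβmono : StrictMonoOn β (Set.Ici 0)) (hβ0 : β 0 = 0)
    {V : ℝ → ℝ} (c : ℝ) {σ : Measure ℝ} [IsFiniteMeasure σ] (hVi : Integrable V σ)
    (hEi : Integrable (fun x => Edens β ((σ.rnDeriv volume x).toReal))) :
    Integrable (fun x => V x - c) (σ.singularPart volume) ∧
    Integrable (fun x => Edens β ((σ.rnDeriv volume x).toReal) +
      (V x - c) * (σ.rnDeriv volume x).toReal) ∧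
    Fent β V σ = (((∫ x, (Edens β ((σ.rnDeriv volume x).toReal) +
      (V x - c) * (σ.rnDeriv volume x).toReal)) +
      (∫ x, (V x - c) ∂(σ.singularPart volume)) + c * σ.real univ : ℝ) : EReal) := by
  have hVc : Integrable (fun x => V x - c) σ := hVi.sub (integrable_const c)
  have hdec := Measure.haveLebesgueDecomposition_add σ volume
  have hVc' := hVc
  rw [hdec] at hVc'
  have hs := hVc'.left_of_add_measure
  have hw := hVc'.right_of_add_measure
  have hmeas := Measure.measurable_rnDeriv σ volume
  have hlt := Measure.rnDeriv_lt_top σ volume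
  have hw2 := (integrable_withDensity_iff_integrable_smul' hmeas hlt).1 hw
  have hw3 : Integrable (fun x => (V x - c) * (σ.rnDeriv volume x).toReal) := by
    simpa only [smul_eq_mul, mul_comm] using hw2
  refine ⟨hs, hEi.add hw3, ?_⟩
  rw [Fent_eq hβmono hβ0 hVi hEi, integral_add hEi hw3]
  congr 1
  have e1 : ∫ x, V x ∂σ = (∫ x, (V x - c) ∂σ) + c * σ.real univ := by
    rw [integral_sub hVi (integrable_const c), integral_const, smul_eq_mul]
    ring
  have e2 : (∫ x, (V x - c) ∂σ) = (∫ x, (V x - c) ∂(σ.singularPart volume)) +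
      ∫ x, (V x - c) * (σ.rnDeriv volume x).toReal := by
    conv_lhs => rw [hdec]
    rw [integral_add_measure hs hw, integral_withDensity_eq_integral_toReal_smul hmeas hlt]
    simp only [smul_eq_mul, mul_comm]
  rw [e1, e2]
  ring
end fent

section comp
variable {β : ℝ → ℝ}

/-- energy of the truncated competitor -/
lemma Fent_comp (hβ : ContDiff ℝ 1 β) (hβmono : StrictMonoOn β (Set.Ici 0)) (hβ0 : β 0 = 0)
    {V : ℝ → ℝ} (hV : Continuous V) {v0 x0 : ℝ} {h : ℝ → ℝ≥0∞} (hh : Measurable h)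
    (hfin : ∀ᵐ x, h x < ⊤) (hint : Integrable (fun x => (h x).toReal))
    (hβint : Integrable (fun x => β (h x).toReal))
    (hE : ∀ᵐ x, Edens β (h x).toReal + (V x - v0) * (h x).toReal = - β (h x).toReal)
    (n : ℕ) {c : ℝ} (hc : 0 ≤ c) :
    ∃ σ : Measure ℝ, IsFiniteMeasure σ ∧
      σ Set.univ = ENNReal.ofReal (c + ∫ x in Icc (-(n:ℝ)) n, (h x).toReal) ∧
      Fent β V σ = (((∫ x in Icc (-(n:ℝ)) n, - β (h x).toReal) + c * (V x0 - v0)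
        + v0 * (c + ∫ x in Icc (-(n:ℝ)) n, (h x).toReal) : ℝ) : EReal) := by
  set S := Icc (-(n:ℝ)) n with hS
  have hSm : MeasurableSet S := measurableSet_Icc
  set k : ℝ → ℝ≥0∞ := S.indicator h with hk
  have hkm : Measurable k := hh.indicator hSm
  have hkfin : ∀ᵐ x, k x < ⊤ := by
    filter_upwards [hfin] with x hx
    by_cases hxS : x ∈ S <;> simp [hk, hxS, hx]
  have hkR : ∀ x, (k x).toReal = S.indicator (fun x => (h x).toReal) x := by
    intro x
    by_cases hxS : x ∈ S <;> simp [hk, hxS]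
  set s : Measure ℝ := ENNReal.ofReal c • Measure.dirac x0 with hs
  have hsing : s ⟂ₘ volume := (mutuallySingular_dirac x0 volume).smul _
  set σ : Measure ℝ := s + volume.withDensity k with hσ
  have hI0 : 0 ≤ ∫ x in S, (h x).toReal := integral_nonneg fun x => ENNReal.toReal_nonneg
  have hlin : ∫⁻ x, k x = ENNReal.ofReal (∫ x in S, (h x).toReal) := by
    rw [ofReal_integral_eq_lintegral_ofReal hint.integrableOn
      (Eventually.of_forall fun x => ENNReal.toReal_nonneg), hk, lintegral_indicator hSm]
    refine lintegral_congr_ae (ae_restrict_of_ae ?_)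
    filter_upwards [hfin] with x hx
    exact (ENNReal.ofReal_toReal hx.ne).symm
  have hmass : σ univ = ENNReal.ofReal (c + ∫ x in S, (h x).toReal) := by
    rw [hσ, Measure.add_apply, withDensity_apply _ MeasurableSet.univ, Measure.restrict_univ, hlin,
      ENNReal.ofReal_add hc hI0, hs]
    simp
  have hσfin : IsFiniteMeasure σ := ⟨by rw [hmass]; exact ENNReal.ofReal_lt_top⟩
  refine ⟨σ, hσfin, hmass, ?_⟩
  have hrn : k =ᵐ[volume] σ.rnDeriv volume := Measure.eq_rnDeriv hkm hsing hσ
  have hsp : s = σ.singularPart volume := Measure.eq_singularPart hkm hsing hσ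
  have hVh : IntegrableOn (fun x => V x * (h x).toReal) S :=
    IntegrableOn.continuousOn_mul hV.continuousOn hint.integrableOn isCompact_Icc
  have hVi : Integrable V σ := by
    refine Integrable.add_measure ?_ ?_
    · exact (integrable_dirac (by simp)).smul_measure ENNReal.ofReal_ne_top
    · rw [integrable_withDensity_iff_integrable_smul' hkm hkfin]
      refine (hVh.integrable_indicator hSm).congr (Eventually.of_forall fun x => ?_)
      simp only [hkR]
      by_cases hxS : x ∈ S <;> simp [hxS, mul_comm]
  have hEk : (fun x => S.indicator (fun x => - β (h x).toReal - (V x * (h x).toReal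
      - v0 * (h x).toReal)) x) =ᵐ[volume] fun x => Edens β ((σ.rnDeriv volume x).toReal) := by
    filter_upwards [hrn, hE] with x h1 h2
    rw [← h1, hkR]
    by_cases hxS : x ∈ S
    · simp only [indicator_of_mem hxS]; linarith
    · simp only [indicator_of_notMem hxS]; simp [Edens, hβ0]
  have hEi : Integrable (fun x => Edens β ((σ.rnDeriv volume x).toReal)) := by
    refine Integrable.congr ?_ hEk
    refine IntegrableOn.integrable_indicator ?_ hSm
    exact hβint.neg.integrableOn.sub (hVh.sub (hint.const_mul v0).integrableOn)
  rw [(Fent_repr hβmono hβ0 v0 hVi hEi).2.2, ← hsp]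
  congr 1
  have e1 : ∫ x, (Edens β ((σ.rnDeriv volume x).toReal) +
      (V x - v0) * (σ.rnDeriv volume x).toReal) = ∫ x in S, - β (h x).toReal := by
    rw [← integral_indicator hSm]
    refine integral_congr_ae ?_
    filter_upwards [hrn, hE] with x h1 h2
    rw [← h1, hkR]
    by_cases hxS : x ∈ S
    · simp only [indicator_of_mem hxS]; linarith
    · simp only [indicator_of_notMem hxS]; simp [Edens, hβ0]
  have e2 : ∫ x, (V x - v0) ∂s = c * (V x0 - v0) := by
    rw [hs, integral_smul_measure, integral_dirac, ENNReal.toReal_ofReal hc, smul_eq_mul]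
  have e3 : σ.real univ = c + ∫ x in S, (h x).toReal := by
    rw [Measure.real, hmass, ENNReal.toReal_ofReal (add_nonneg hc hI0)]
  rw [e1, e2, e3]
end comp

/-- every minimizer of the entropy functional `F` on measures of mass `m`
has the predicted structure: its density is `H(V(·) - 𝔳)` a.e., its singular part is
concentrated on `Q` and has total mass `(m - m_c)⁺`; in particular it vanishes when `m < m_c`. -/
theorem minimizer_has_predicted_form
    (β V : ℝ → ℝ) (βinf lam Vmin m v0 : ℝ)
    (H : ℝ → ℝ≥0∞)
    (hβ : ContDiff ℝ 1 β) (hβmono : StrictMonoOn β (Set.Ici 0)) (hβ0 : β 0 = 0)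
    (hβlim : Tendsto β atTop (𝓝 βinf))
    (hV : ContDiff ℝ 2 V) (hVpp : ∀ x : ℝ, lam ≤ deriv (deriv V) x)
    (hVcoer : Tendsto V (cocompact ℝ) atTop)
    (hVmin : IsLeast (Set.range V) Vmin)
    (hd : 0 < dcrit β)
    (hH1 : ∀ v : ℝ, 0 < v → ENNReal.ofReal v < dcrit β →
      H v ≠ 0 ∧ H v ≠ ⊤ ∧ (∫ s in Set.Ioi ((H v).toReal), deriv β s / s) = v)
    (hHuniq : ∀ v r : ℝ, 0 < v → ENNReal.ofReal v < dcrit β → 0 < r →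
      (∫ s in Set.Ioi r, deriv β s / s) = v → ENNReal.ofReal r = H v)
    (hH2 : ∀ v : ℝ, dcrit β ≤ ENNReal.ofReal v → H v = 0)
    (hH3 : ∀ v : ℝ, v ≤ 0 → H v = ⊤)
    (hint : ∃ Qt : Set ℝ, IsOpen Qt ∧ Bornology.IsBounded Qt ∧
      {x : ℝ | V x = Vmin} ⊆ Qt ∧ (∫⁻ x in Qtᶜ, H (V x - Vmin)) < ⊤)
    (hm : 0 < m)
    (hv0a : ENNReal.ofReal (Vmin - v0) < dcrit β) (hv0b : v0 ≤ Vmin)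
    (hv0c : (∫⁻ x, H (V x - v0)) = min (ENNReal.ofReal m) (mcrit H V Vmin))
    (hv0d : mcrit H V Vmin ≤ ENNReal.ofReal m → v0 = Vmin)
    -- the minimizer:
    (ρ : Measure ℝ) (hρfin : IsFiniteMeasure ρ) (hρmass : ρ Set.univ = ENNReal.ofReal m)
    (hFne_top : Fent β V ρ ≠ ⊤) (hFne_bot : Fent β V ρ ≠ ⊥)
    (hmin : ∀ σ : Measure ℝ, IsFiniteMeasure σ → σ Set.univ = ENNReal.ofReal m →
      Fent β V ρ ≤ Fent β V σ) :
    (∀ᵐ x ∂(volume : Measure ℝ), ρ.rnDeriv volume x = H (V x - v0)) ∧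
      ρ.singularPart volume {x : ℝ | V x = Vmin}ᶜ = 0 ∧
      ρ.singularPart volume Set.univ = ENNReal.ofReal m - mcrit H V Vmin ∧
      (ENNReal.ofReal m < mcrit H V Vmin → ρ.singularPart volume = 0) := by
  
  have hVc : Continuous V := hV.continuous
  have hVge : ∀ x, Vmin ≤ V x := fun x => hVmin.2 ⟨x, rfl⟩
  obtain ⟨x0, hx0⟩ := hVmin.1
  have hHm : Measurable H := (H_antitone hβ hβmono hβlim hH1 hH2 hH3).measurable
  set h : ℝ → ℝ≥0∞ := fun x => H (V x - v0) with hh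
  have hhm : Measurable h := hHm.comp (hVc.measurable.sub_const v0)
  have hlin : ∫⁻ x, h x ≠ ⊤ := by
    rw [hv0c]; exact ne_top_of_le_ne_top ENNReal.ofReal_ne_top (min_le_left _ _)
  have hfin : ∀ᵐ x, h x < ⊤ := ae_lt_top hhm hlin
  have hint' : Integrable (fun x => (h x).toReal) :=
    integrable_toReal_of_lintegral_ne_top hhm.aemeasurable hlin
  have hβint : Integrable (fun x => β (h x).toReal) := by
    obtain ⟨C, hC⟩ := b_le_lin hβ hβmono hβ0 hβlim
    refine Integrable.mono' (hint'.const_mul C) ?_ (Eventually.of_forall fun x => ?_)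
    · exact (hβ.continuous.measurable.comp hhm.ennreal_toReal).aestronglyMeasurable
    · rw [Real.norm_of_nonneg (b_nonneg hβmono hβ0 ENNReal.toReal_nonneg)]
      exact hC _ ENNReal.toReal_nonneg
  have hpt : ∀ᵐ x, Edens β (h x).toReal + (V x - v0) * (h x).toReal = - β (h x).toReal ∧
      ∀ r : ℝ, 0 ≤ r → r ≠ (h x).toReal → - β (h x).toReal < Edens β r + (V x - v0) * r := by
    filter_upwards [hfin] with x hx
    refine pointwise hβ hβmono hβ0 hβlim hH1 hH2 ?_
    by_contra! hle
    have := hH3 _ hle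
    simp only [hh, this, lt_self_iff_false] at hx
  have hE := hpt.mono fun x hx => hx.1
  have hIm : ∫ x, (h x).toReal = (∫⁻ x, h x).toReal := integral_toReal hhm.aemeasurable hfin
  have hIle : ∫ x, (h x).toReal ≤ m := by
    rw [hIm, hv0c]
    calc _ ≤ (ENNReal.ofReal m).toReal :=
          ENNReal.toReal_mono ENNReal.ofReal_ne_top (min_le_left _ _)
      _ = m := ENNReal.toReal_ofReal hm.le
  have hslack : (m - ∫ x, (h x).toReal) * (Vmin - v0) = 0 := by
    rcases le_or_gt (mcrit H V Vmin) (ENNReal.ofReal m) with hc | hc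
    · rw [hv0d hc]; ring
    · rw [hIm, hv0c, min_eq_left hc.le, ENNReal.toReal_ofReal hm.le]; ring
  -- the minimizer
  obtain ⟨hρV, hρE⟩ := Fent_int hβ hβmono hβ0 hVc hVge hFne_top hFne_bot
  obtain ⟨hsI, hfI, hFρ⟩ := Fent_repr hβmono hβ0 v0 hρV hρE
  have hρreal : ρ.real univ = m := by
    rw [Measure.real, hρmass, ENNReal.toReal_ofReal hm.le]
  rw [hρreal] at hFρ
  set u : ℝ → ℝ := fun x => (ρ.rnDeriv volume x).toReal with hu
  set A := ∫ x, (Edens β (u x) + (V x - v0) * u x) with hA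
  set B := ∫ x, (V x - v0) ∂(ρ.singularPart volume) with hB
  have hn : ∀ n : ℕ, A + B ≤ (∫ x in Icc (-(n:ℝ)) n, - β (h x).toReal) +
      (m - ∫ x in Icc (-(n:ℝ)) n, (h x).toReal) * (Vmin - v0) := by
    intro n
    have hc : 0 ≤ m - ∫ x in Icc (-(n:ℝ)) n, (h x).toReal := by
      have := setIntegral_le_integral (s := Icc (-(n:ℝ)) n) hint'
        (Eventually.of_forall fun x => ENNReal.toReal_nonneg)
      linarith
    obtain ⟨σ, s1, s2, s3⟩ := Fent_comp (x0 := x0) hβ hβmono hβ0 hVc hhm hfin hint' hβint hE n hc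
    rw [sub_add_cancel] at s2 s3
    have := hmin σ s1 s2
    rw [hFρ, s3, EReal.coe_le_coe_iff, hx0] at this
    linarith
  have hcov : AECover (volume : Measure ℝ) atTop (fun n : ℕ => Icc (-(n:ℝ)) (n:ℝ)) :=
    aecover_Icc (tendsto_neg_atTop_atBot.comp tendsto_natCast_atTop_atTop)
      tendsto_natCast_atTop_atTop
  have hAB : A + B ≤ ∫ x, - β (h x).toReal := by
    have l1 := hcov.integral_tendsto_of_countably_generated hβint.neg
    have l2 := hcov.integral_tendsto_of_countably_generated hint'
    have l3 := l1.add ((l2.const_sub m).mul_const (Vmin - v0))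
    rw [hslack, add_zero] at l3
    exact ge_of_tendsto' l3 hn
  have hgap : ∀ᵐ x, 0 ≤ (Edens β (u x) + (V x - v0) * u x) - - β (h x).toReal := by
    filter_upwards [hpt] with x hx
    by_cases he : u x = (h x).toReal
    · rw [he, hx.1, sub_self]
    · exact (sub_pos.2 (hx.2 _ ENNReal.toReal_nonneg he)).le
  have hgapI : Integrable (fun x => (Edens β (u x) + (V x - v0) * u x) - - β (h x).toReal) :=
    hfI.sub hβint.neg
  have hgint : ∫ x, ((Edens β (u x) + (V x - v0) * u x) - - β (h x).toReal)
      = A - ∫ x, - β (h x).toReal := integral_sub hfI hβint.neg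
  have hg0 := integral_nonneg_of_ae hgap
  have hVv : ∀ x, 0 ≤ V x - v0 := fun x => by linarith [hVge x]
  have hB0 : 0 ≤ B := integral_nonneg hVv
  have hgz : ∫ x, ((Edens β (u x) + (V x - v0) * u x) - - β (h x).toReal) = 0 := by linarith
  have hBz : B = 0 := by linarith
  have hae : ∀ᵐ x, ρ.rnDeriv volume x = h x := by
    filter_upwards [(integral_eq_zero_iff_of_nonneg_ae hgap hgapI).1 hgz, hpt, hfin,
      Measure.rnDeriv_lt_top ρ volume] with x k1 k2 k3 k4
    refine (ENNReal.toReal_eq_toReal_iff' k4.ne k3.ne).1 ?_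
    by_contra hne
    have := k2.2 (u x) ENNReal.toReal_nonneg hne
    simp only [Pi.zero_apply] at k1
    linarith
  have hsz := (integral_eq_zero_iff_of_nonneg_ae (Eventually.of_forall hVv) hsI).1 hBz
  have hmass : ρ.singularPart volume univ = ENNReal.ofReal m - mcrit H V Vmin := by
    have e := congrArg (fun μ : Measure ℝ => μ univ) (Measure.haveLebesgueDecomposition_add ρ volume)
    simp only [Measure.add_apply, withDensity_apply _ MeasurableSet.univ,
      Measure.restrict_univ] at e
    rw [lintegral_congr_ae hae, hρmass, hv0c] at e
    have hmt : min (ENNReal.ofReal m) (mcrit H V Vmin) ≠ ⊤ :=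
      ne_top_of_le_ne_top ENNReal.ofReal_ne_top (min_le_left _ _)
    have e' := ENNReal.eq_sub_of_add_eq hmt e.symm
    rw [e']
    rcases le_total (ENNReal.ofReal m) (mcrit H V Vmin) with hc | hc
    · rw [min_eq_left hc, tsub_self, tsub_eq_zero_of_le hc]
    · rw [min_eq_right hc]
  refine ⟨hae, ?_, hmass, ?_⟩
  · refine measure_mono_null ?_ hsz
    intro x hx hx2
    apply hx
    simp only [Pi.zero_apply, mem_setOf_eq] at hx2 ⊢
    linarith [hVge x]
  · intro hlt
    rw [tsub_eq_zero_of_le hlt.le] at hmass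
    exact Measure.measure_univ_eq_zero.1 hmass
end

section
/- The mass function M(v) := ∫_ℝ H(V(x) − v) dx is an increasing homeomorphism onto its range: for every v ∈ (V_min − 𝔡, V_min) one has 0 < M(v) < +∞, the function M is strictly increasing and continuous on (V_min − 𝔡, V_min), M(v) → 0 as v ↓ V_min − 𝔡, and M(v) → m_c as v ↑ V_min. -/
open MeasureTheory Set Filter Topology
open scoped ENNReal

lemma aux_deriv_nonneg (β : ℝ → ℝ) (hβmono : StrictMonoOn β (Set.Ici 0)) (s : ℝ) (hs : 0 < s) :
    0 ≤ deriv β s := by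
  rw [← derivWithin_of_mem_nhds (Ici_mem_nhds hs)]
  exact hβmono.monotoneOn.derivWithin_nonneg

lemma aux_int (β : ℝ → ℝ) (βinf : ℝ) (hβ : ContDiff ℝ 1 β) (hβmono : StrictMonoOn β (Set.Ici 0))
    (hβlim : Tendsto β atTop (𝓝 βinf)) (r : ℝ) (hr : 0 < r) :
    IntegrableOn (fun s => deriv β s / s) (Ioi r) := by
  have h1 : IntegrableOn (deriv β) (Ioi r) := by
    refine integrableOn_Ioi_deriv_of_nonneg (g := β) (l := βinf) hβ.continuous.continuousWithinAt ?_ ?_ hβlim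
    · intro x hx
      exact (hβ.differentiable (by norm_num) x).hasDerivAt
    · intro x hx
      exact aux_deriv_nonneg β hβmono x (hr.trans hx)
  have h2 : IntegrableOn (fun s => r⁻¹ * deriv β s) (Ioi r) := h1.const_mul _
  refine Integrable.mono' h2 ?_ ?_
  · exact ((hβ.continuous_deriv le_rfl).measurable.div measurable_id).aestronglyMeasurable
  · filter_upwards [ae_restrict_mem measurableSet_Ioi] with s hs
    have hs' : r < s := hs
    have h0 := aux_deriv_nonneg β hβmono s (hr.trans hs')
    rw [Real.norm_of_nonneg (div_nonneg h0 (hr.trans hs').le), div_eq_inv_mul]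
    gcongr

lemma aux_pos (β : ℝ → ℝ) (hβ : ContDiff ℝ 1 β) (hβmono : StrictMonoOn β (Set.Ici 0))
    (a b : ℝ) (ha : 0 ≤ a) (hab : a < b) :
    0 < ∫⁻ s in Ioc a b, ENNReal.ofReal (deriv β s / s) := by
  rw [pos_iff_ne_zero]
  intro h
  have hc := hβ.continuous_deriv le_rfl
  rw [lintegral_eq_zero_iff (by fun_prop)] at h
  have h3 : ∫ s in a..b, deriv β s = β b - β a :=
    intervalIntegral.integral_deriv_eq_sub (fun x _ => hβ.differentiable (by norm_num) x)
      (hc.intervalIntegrable _ _)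
  rw [intervalIntegral.integral_of_le hab.le] at h3
  have h4 : ∫ s in Ioc a b, deriv β s = 0 := by
    apply integral_eq_zero_of_ae
    filter_upwards [h, ae_restrict_mem measurableSet_Ioc] with s hs hm
    have hs0 : 0 < s := ha.trans_lt hm.1
    have h0 := aux_deriv_nonneg β hβmono s hs0
    simp only [Pi.zero_apply, ENNReal.ofReal_eq_zero] at hs ⊢
    rw [div_le_iff₀ hs0] at hs
    linarith
  have := hβmono (show a ∈ Ici (0:ℝ) from ha) (show b ∈ Ici (0:ℝ) from ha.trans hab.le) hab
  linarith

lemma aux_ofReal (β : ℝ → ℝ) (βinf : ℝ) (hβ : ContDiff ℝ 1 β)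
    (hβmono : StrictMonoOn β (Set.Ici 0))
    (hβlim : Tendsto β atTop (𝓝 βinf)) (r : ℝ) (hr : 0 < r) :
    ENNReal.ofReal (∫ s in Ioi r, deriv β s / s) = ∫⁻ s in Ioi r, ENNReal.ofReal (deriv β s / s) := by
  apply ofReal_integral_eq_lintegral_ofReal (aux_int β βinf hβ hβmono hβlim r hr)
  filter_upwards [ae_restrict_mem measurableSet_Ioi] with s hs
  exact div_nonneg (aux_deriv_nonneg β hβmono s (hr.trans hs)) (hr.trans hs).le

lemma aux_split (β : ℝ → ℝ) (a b : ℝ) (hab : a ≤ b) :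
    ∫⁻ s in Ioi a, ENNReal.ofReal (deriv β s / s) =
    (∫⁻ s in Ioc a b, ENNReal.ofReal (deriv β s / s)) +
      ∫⁻ s in Ioi b, ENNReal.ofReal (deriv β s / s) := by
  rw [← Ioc_union_Ioi_eq_Ioi hab, lintegral_union measurableSet_Ioi]
  exact Set.disjoint_left.2 fun x hx hx' => not_lt.2 hx.2 hx'

lemma aux_H (β : ℝ → ℝ) (βinf : ℝ) (H : ℝ → ℝ≥0∞)
    (hβ : ContDiff ℝ 1 β) (hβmono : StrictMonoOn β (Set.Ici 0))
    (hβlim : Tendsto β atTop (𝓝 βinf))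
    (hH1 : ∀ v : ℝ, 0 < v → ENNReal.ofReal v < dcrit β →
      H v ≠ 0 ∧ H v ≠ ⊤ ∧ (∫ s in Set.Ioi ((H v).toReal), deriv β s / s) = v)
    (hHuniq : ∀ v r : ℝ, 0 < v → ENNReal.ofReal v < dcrit β → 0 < r →
      (∫ s in Set.Ioi r, deriv β s / s) = v → ENNReal.ofReal r = H v)
    (hH2 : ∀ v : ℝ, dcrit β ≤ ENNReal.ofReal v → H v = 0)
    (hH3 : ∀ v : ℝ, v ≤ 0 → H v = ⊤) :
    Antitone H ∧ Continuous H ∧ Tendsto H atTop (𝓝 0) := by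
  have key : ∀ r : ℝ, 0 < r → ∃ v, ENNReal.ofReal r = H v := by
    intro r hr
    refine ⟨_, hHuniq _ r ?_ ?_ hr rfl⟩
    · rw [← ENNReal.ofReal_pos, aux_ofReal β βinf hβ hβmono hβlim r hr,
        aux_split β r (r+1) (by linarith)]
      exact (aux_pos β hβ hβmono r (r+1) hr.le (by linarith)).trans_le le_self_add
    · have e := aux_ofReal β βinf hβ hβmono hβlim r hr
      have : dcrit β = _ := aux_split β 0 r hr.le
      rw [this, ← e, add_comm]
      exact ENNReal.lt_add_right ENNReal.ofReal_ne_top (aux_pos β hβ hβmono 0 r le_rfl hr).ne'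
  have anti : Antitone H := by
    intro v w hvw
    rcases le_or_gt v 0 with hv | hv
    · rw [hH3 v hv]; exact le_top
    rcases le_or_gt (dcrit β) (ENNReal.ofReal w) with hw | hw
    · rw [hH2 w hw]; exact zero_le
    obtain ⟨a1, a2, a3⟩ := hH1 v hv ((ENNReal.ofReal_le_ofReal hvw).trans_lt hw)
    obtain ⟨b1, b2, b3⟩ := hH1 w (hv.trans_le hvw) hw
    by_contra! hlt
    have hr : (H v).toReal < (H w).toReal := (ENNReal.toReal_lt_toReal a2 b2).2 hlt
    have hp : 0 < (H v).toReal := ENNReal.toReal_pos a1 a2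
    have e1 := aux_ofReal β βinf hβ hβmono hβlim _ hp
    have e2 := aux_ofReal β βinf hβ hβmono hβlim _ (hp.trans hr)
    rw [aux_split β _ _ hr.le, ← e2, a3, b3, add_comm] at e1
    have := ENNReal.lt_add_right (ENNReal.ofReal_ne_top (r := w))
      (aux_pos β hβ hβmono _ _ hp.le hr).ne'
    rw [← e1] at this
    exact not_lt.2 (ENNReal.ofReal_le_ofReal hvw) this
  refine ⟨anti, ?_, ?_⟩
  · have hm : Monotone (fun v => H (-v)) := fun a b h => anti (neg_le_neg h)
    have hc : Continuous (fun v => H (-v)) := by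
      apply hm.continuous_of_denseRange
      rw [DenseRange]
      have hd : Dense (Ioo (0:ℝ≥0∞) ⊤) := by
        rw [dense_iff_closure_eq, closure_Ioo (by simp)]
        ext x; simp
      refine hd.mono ?_
      intro x hx
      obtain ⟨v, hv⟩ := key x.toReal (ENNReal.toReal_pos hx.1.ne' hx.2.ne)
      refine ⟨-v, ?_⟩
      simp only [neg_neg]
      rw [← hv, ENNReal.ofReal_toReal hx.2.ne]
    have hc2 := hc.comp continuous_neg
    simpa only [Function.comp_def, neg_neg] using hc2
  · rw [ENNReal.tendsto_nhds_zero]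
    intro ε hε
    rcases eq_or_ne ε ⊤ with h | h
    · simp [h]
    obtain ⟨v, hv⟩ := key ε.toReal (ENNReal.toReal_pos hε.ne' h)
    filter_upwards [eventually_ge_atTop v] with w hw
    rw [ENNReal.ofReal_toReal h] at hv
    rw [hv]; exact anti hw

/-- the mass function `M(v) = ∫_ℝ H(V(x) - v) dx` is finite and positive on
`(V_min - 𝔡, V_min)`, strictly increasing and continuous there, tends to `0` as
`v ↓ V_min - 𝔡` (i.e. as `v → -∞` when `𝔡 = +∞`) and to `m_c` as `v ↑ V_min`. -/
theorem mass_function_homeomorphism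
    (β V : ℝ → ℝ) (βinf lam Vmin : ℝ)
    (H : ℝ → ℝ≥0∞)
    (hβ : ContDiff ℝ 1 β) (hβmono : StrictMonoOn β (Set.Ici 0)) (hβ0 : β 0 = 0)
    (hβlim : Tendsto β atTop (𝓝 βinf))
    (hV : ContDiff ℝ 2 V) (hVpp : ∀ x : ℝ, lam ≤ deriv (deriv V) x)
    (hVcoer : Tendsto V (cocompact ℝ) atTop)
    (hVmin : IsLeast (Set.range V) Vmin)
    (hd : 0 < dcrit β)
    (hH1 : ∀ v : ℝ, 0 < v → ENNReal.ofReal v < dcrit β →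
      H v ≠ 0 ∧ H v ≠ ⊤ ∧ (∫ s in Set.Ioi ((H v).toReal), deriv β s / s) = v)
    (hHuniq : ∀ v r : ℝ, 0 < v → ENNReal.ofReal v < dcrit β → 0 < r →
      (∫ s in Set.Ioi r, deriv β s / s) = v → ENNReal.ofReal r = H v)
    (hH2 : ∀ v : ℝ, dcrit β ≤ ENNReal.ofReal v → H v = 0)
    (hH3 : ∀ v : ℝ, v ≤ 0 → H v = ⊤)
    (hint : ∃ Qt : Set ℝ, IsOpen Qt ∧ Bornology.IsBounded Qt ∧
      {x : ℝ | V x = Vmin} ⊆ Qt ∧ (∫⁻ x in Qtᶜ, H (V x - Vmin)) < ⊤) :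
    (∀ v : ℝ, v < Vmin → ENNReal.ofReal (Vmin - v) < dcrit β →
        0 < (∫⁻ x, H (V x - v)) ∧ (∫⁻ x, H (V x - v)) < ⊤) ∧
      StrictMonoOn (fun v : ℝ => ∫⁻ x, H (V x - v))
        {v : ℝ | v < Vmin ∧ ENNReal.ofReal (Vmin - v) < dcrit β} ∧
      ContinuousOn (fun v : ℝ => ∫⁻ x, H (V x - v))
        {v : ℝ | v < Vmin ∧ ENNReal.ofReal (Vmin - v) < dcrit β} ∧
      (dcrit β ≠ ⊤ → Tendsto (fun v : ℝ => ∫⁻ x, H (V x - v))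
        (𝓝[>] (Vmin - (dcrit β).toReal)) (𝓝 0)) ∧
      (dcrit β = ⊤ → Tendsto (fun v : ℝ => ∫⁻ x, H (V x - v)) atBot (𝓝 0)) ∧
      Tendsto (fun v : ℝ => ∫⁻ x, H (V x - v)) (𝓝[<] Vmin) (𝓝 (mcrit H V Vmin)) := by
  obtain ⟨anti, cont, lim0⟩ := aux_H β βinf H hβ hβmono hβlim hH1 hHuniq hH2 hH3
  obtain ⟨⟨xm, hxm⟩, hlb⟩ := hVmin
  have hlb' : ∀ x, Vmin ≤ V x := fun x => hlb ⟨x, rfl⟩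
  have hVc : Continuous V := hV.continuous
  have hcf : ∀ v, Continuous (fun x => H (V x - v)) := fun v => cont.comp (hVc.sub continuous_const)
  have hmono : Monotone (fun v : ℝ => ∫⁻ x, H (V x - v)) :=
    fun a b hab => lintegral_mono fun x => anti (by linarith)
  have hfin : ∀ v : ℝ, v < Vmin → (∫⁻ x, H (V x - v)) < ⊤ := by
    intro v hv
    obtain ⟨Qt, ho, hb, hQ, hi⟩ := hint
    rw [← lintegral_add_compl _ ho.measurableSet]
    refine ENNReal.add_lt_top.2 ⟨?_, lt_of_le_of_lt (lintegral_mono fun x => anti (by linarith)) hi⟩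
    have hne : H (Vmin - v) < ⊤ := by
      rcases le_or_gt (dcrit β) (ENNReal.ofReal (Vmin - v)) with hw | hw
      · rw [hH2 _ hw]; exact ENNReal.zero_lt_top
      · exact (hH1 _ (by linarith) hw).2.1.lt_top
    calc ∫⁻ x in Qt, H (V x - v) ≤ ∫⁻ x in Qt, H (Vmin - v) :=
          lintegral_mono fun x => anti (by linarith [hlb' x])
      _ = H (Vmin - v) * volume Qt := by simp
      _ < ⊤ := ENNReal.mul_lt_top hne hb.measure_lt_top
  have hct : ∀ v0 : ℝ, v0 < Vmin → ContinuousAt (fun v : ℝ => ∫⁻ x, H (V x - v)) v0 := by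
    intro v0 hv0
    obtain ⟨w, hw1, hw2⟩ := exists_between hv0
    refine tendsto_lintegral_filter_of_dominated_convergence (fun x => H (V x - w)) ?_ ?_
      (hfin w hw2).ne ?_
    · exact Eventually.of_forall fun v => (hcf v).measurable
    · filter_upwards [Iio_mem_nhds hw1] with v hv
      have hv' : v < w := hv
      exact Eventually.of_forall fun x => anti (by linarith)
    · refine Eventually.of_forall fun x => ?_
      exact (cont.comp (continuous_const.sub continuous_id)).tendsto v0
  refine ⟨?_, ?_, ?_, ?_, ?_, ?_⟩
  · intro v hv hvd
    refine ⟨?_, hfin v hv⟩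
    rw [pos_iff_ne_zero]
    intro h
    rw [lintegral_eq_zero_iff (hcf v).measurable] at h
    have h2 := ((hcf v).ae_eq_iff_eq volume continuous_const).1 h
    have h3 := congrFun h2 xm
    simp only [hxm, Pi.zero_apply] at h3
    exact (hH1 _ (by linarith) hvd).1 h3
  · rintro v ⟨hv, hvd⟩ w ⟨hw, hwd⟩ hvw
    refine lt_of_le_of_ne (hmono hvw.le) ?_
    intro h
    have h1 := ae_eq_of_ae_le_of_lintegral_le
      (Eventually.of_forall fun x => anti (by linarith : V x - w ≤ V x - v))
      (hfin v hv).ne (hcf w).aemeasurable (le_of_eq h.symm)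
    have h2 := congrFun (((hcf v).ae_eq_iff_eq volume (hcf w)).1 h1) xm
    simp only [hxm] at h2
    have e1 := (hH1 _ (by linarith) hvd).2.2
    have e2 := (hH1 _ (by linarith) hwd).2.2
    rw [h2, e2] at e1
    linarith
  · intro v hv
    exact (hct v hv.1).continuousWithinAt
  · intro hdt
    have hpos : 0 < (dcrit β).toReal := ENNReal.toReal_pos hd.ne' hdt
    have h := (hct (Vmin - (dcrit β).toReal) (by linarith)).tendsto
    have h0 : (∫⁻ x, H (V x - (Vmin - (dcrit β).toReal))) = 0 := by
      have : ∀ x, H (V x - (Vmin - (dcrit β).toReal)) = 0 := by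
        intro x
        apply hH2
        rw [ENNReal.le_ofReal_iff_toReal_le hdt (by linarith [hlb' x])]
        linarith [hlb' x]
      simp [this]
    simp only [h0] at h
    exact h.mono_left nhdsWithin_le_nhds
  · intro _
    have h : Tendsto (fun v : ℝ => ∫⁻ x, H (V x - v)) atBot (𝓝 (∫⁻ _ : ℝ, 0)) := by
      refine tendsto_lintegral_filter_of_dominated_convergence (fun x => H (V x - (Vmin - 1))) ?_ ?_
        (hfin (Vmin - 1) (by linarith)).ne ?_
      · exact Eventually.of_forall fun v => (hcf v).measurable
      · filter_upwards [eventually_le_atBot (Vmin - 1)] with v hv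
        exact Eventually.of_forall fun x => anti (by linarith)
      · refine Eventually.of_forall fun x => ?_
        have ht : Tendsto (fun v : ℝ => V x - v) atBot atTop := by
          simp only [sub_eq_add_neg]
          exact tendsto_atTop_add_const_left _ _ tendsto_neg_atBot_atTop
        exact lim0.comp ht
    simpa using h
  · obtain ⟨u, hu1, hu2, hu3⟩ := exists_seq_strictMono_tendsto Vmin
    have hs : Tendsto (fun n => ∫⁻ x, H (V x - u n)) atTop (𝓝 (mcrit H V Vmin)) := by
      refine lintegral_tendsto_of_tendsto_of_monotone (fun n => (hcf (u n)).aemeasurable) ?_ ?_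
      · refine Eventually.of_forall fun x n m hnm => anti ?_
        have := hu1.monotone hnm
        linarith
      · refine Eventually.of_forall fun x => ?_
        exact (cont.tendsto _).comp (tendsto_const_nhds.sub hu3)
    rw [tendsto_order]
    constructor
    · intro a ha
      obtain ⟨n, hn⟩ := ((tendsto_order.1 hs).1 a ha).exists
      filter_upwards [Ioo_mem_nhdsLT (hu2 n)] with v hv
      exact hn.trans_le (hmono hv.1.le)
    · intro a ha
      filter_upwards [self_mem_nhdsWithin] with v hv
      exact (hmono (le_of_lt hv)).trans_lt ha
end

section
/- A priori Lᵖ estimate with at most exponential growth: if u : ℝ × [0,T] → [0,∞) is a C² solution of ∂_t u = ∂_x(∂_x(β(u)) + V'(x)·u) such that there is a compact set K ⊂ ℝ with u(x,t) = 0 for all x ∉ K and all t ∈ [0,T], then for every p ≥ 2, ∫_ℝ u(x,T)^p dx ≤ e^{c(p−1)T} ∫_ℝ u(x,0)^p dx. -/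
open MeasureTheory Set Filter Topology

theorem slice_ineq (b V w : ℝ → ℝ) (c : ℝ)
    (hb : ContDiff ℝ 2 b) (hbmono : MonotoneOn b (Set.Ici 0))
    (hV : ContDiff ℝ 2 V) (hVpp : ∀ x : ℝ, deriv (deriv V) x ≤ c)
    (hw : ContDiff ℝ 2 w) (hwnn : ∀ x, 0 ≤ w x) (R : ℝ) (hR : 0 ≤ R)
    (hw1 : w R = 0) (hw2 : w (-R) = 0) (p : ℝ) (hp : 2 ≤ p) :
    (∫ x in (-R)..R, (deriv (fun y => deriv (fun z => b (w z)) y + deriv V y * w y) x)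
        * p * w x ^ (p - 1)) ≤ c * (p - 1) * ∫ x in (-R)..R, w x ^ p := by
  have hwb : ContDiff ℝ 2 (fun z => b (w z)) := hb.comp hw
  have e2 : (2 : WithTop ℕ∞) = 1 + 1 := by norm_num
  have d1 : ∀ f : ℝ → ℝ, ContDiff ℝ 2 f → ContDiff ℝ 1 (deriv f) := by
    intro f hf
    rw [e2, contDiff_succ_iff_deriv] at hf
    exact hf.2.2
  have hV1 := d1 V hV
  have hw1' := d1 w hw
  set g : ℝ → ℝ := fun y => deriv (fun z => b (w z)) y + deriv V y * w y with hg
  have hgc : ContDiff ℝ 1 g := (d1 _ hwb).add (hV1.mul (hw.of_le (by norm_num)))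
  have hg' : ∀ x, HasDerivAt g (deriv g x) x := fun x =>
    (hgc.differentiable (by norm_num) x).hasDerivAt
  have hgC : Continuous (deriv g) := hgc.continuous_deriv (by norm_num)
  have hVC : Continuous (deriv (deriv V)) := hV1.continuous_deriv (by norm_num)
  have hV' : ∀ x, HasDerivAt (deriv V) (deriv (deriv V) x) x := fun x =>
    (hV1.differentiable (by norm_num) x).hasDerivAt
  have hwd : ∀ x, HasDerivAt w (deriv w x) x := fun x =>
    (hw.differentiable (by norm_num) x).hasDerivAt
  have hwC : Continuous w := hw.continuous
  have hwp : ∀ q : ℝ, 0 ≤ q → Continuous (fun x => w x ^ q) := fun q hq =>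
    hwC.rpow_const (fun x => Or.inr hq)
  set H' : ℝ → ℝ := fun x => (p * (deriv w x * (p - 1) * w x ^ (p - 1 - 1)) * g x
      + p * w x ^ (p - 1) * deriv g x)
      - (p - 1) * (deriv (deriv V) x * w x ^ p + deriv V x * (deriv w x * p * w x ^ (p - 1)))
      with hH'
  have hH : ∀ x, HasDerivAt (fun x => p * w x ^ (p - 1) * g x - (p - 1) * (deriv V x * w x ^ p))
      (H' x) x := by
    intro x
    exact ((((hwd x).rpow_const (p := p - 1) (Or.inr (by linarith))).const_mul p).mul (hg' x)).sub
      (((hV' x).mul ((hwd x).rpow_const (p := p) (Or.inr (by linarith)))).const_mul (p - 1))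
  have c1 := hwp (p - 1) (by linarith)
  have c2 := hwp (p - 1 - 1) (by linarith)
  have c3 := hwp p (by linarith)
  have c4 := hgc.continuous
  have c5 := hV1.continuous
  have c6 := hw1'.continuous
  have hH'C : Continuous H' := by
    rw [hH']
    fun_prop
  have hint : ∫ x in (-R)..R, H' x = 0 := by
    rw [intervalIntegral.integral_eq_sub_of_hasDerivAt (fun x _ => hH x)
      (hH'C.intervalIntegrable _ _)]
    rw [hw1, hw2, Real.zero_rpow (by linarith), Real.zero_rpow (by linarith)]
    ring
  have hbd : ∀ y, 0 ≤ y → 0 ≤ deriv b y := by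
    intro y hy
    have h1 : derivWithin b (Ici 0) y = deriv b y :=
      (hb.differentiable (by norm_num) y).derivWithin (uniqueDiffOn_Ici 0 y hy)
    rw [← h1]
    exact hbmono.derivWithin_nonneg
  have key : (∫ x in (-R)..R, (deriv g x * p * w x ^ (p - 1) - c * (p - 1) * w x ^ p))
      ≤ ∫ x in (-R)..R, H' x := by
    apply intervalIntegral.integral_mono_on (by linarith)
    · exact Continuous.intervalIntegrable (by fun_prop) _ _
    · exact hH'C.intervalIntegrable _ _
    · intro x _
      have hgx : g x = deriv b (w x) * deriv w x + deriv V x * w x := by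
        simp only [hg]
        congr 1
        exact ((hb.differentiable (by norm_num) (w x)).hasDerivAt.comp x (hwd x)).deriv
      have e : w x ^ (p - 1) = w x ^ (p - 1 - 1) * w x := by
        rw [← Real.rpow_add_one' (hwnn x) (by linarith)]
        congr 1; ring
      have i1 : 0 ≤ p * (p - 1) * w x ^ (p - 1 - 1) * (deriv b (w x) * (deriv w x) ^ 2) := by
        have := hbd _ (hwnn x)
        have := Real.rpow_nonneg (hwnn x) (p - 1 - 1)
        have : 0 ≤ p - 1 := by linarith
        have : 0 ≤ p := by linarith
        positivity
      have i2 : 0 ≤ (p - 1) * w x ^ p * (c - deriv (deriv V) x) := by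
        have := Real.rpow_nonneg (hwnn x) p
        have : 0 ≤ p - 1 := by linarith
        have := sub_nonneg.2 (hVpp x)
        positivity
      simp only [hH', hgx]
      rw [e]
      nlinarith [i1, i2]
  rw [hint, intervalIntegral.integral_sub (Continuous.intervalIntegrable (by fun_prop) _ _)
    (Continuous.intervalIntegrable (by fun_prop) _ _), intervalIntegral.integral_const_mul] at key
  linarith



/-- a priori `Lᵖ` estimate with at most exponential growth for compactly
supported nonnegative smooth solutions of `∂_t u = ∂_x(∂_x β(u) + V' u)` on `ℝ × [0,T]`,
when `V'' ≤ c`: for every `p ≥ 2`, `∫ u(·,T)^p ≤ e^{c(p-1)T} ∫ u(·,0)^p`. -/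
theorem apriori_Lp_estimate
    (b V : ℝ → ℝ) (c : ℝ)
    (hb : ContDiff ℝ 2 b) (hbmono : MonotoneOn b (Set.Ici 0)) (hb0 : b 0 = 0)
    (hV : ContDiff ℝ 2 V) (hVpp : ∀ x : ℝ, deriv (deriv V) x ≤ c)
    (T : ℝ) (hT : 0 < T) (u : ℝ → ℝ → ℝ)
    (hureg : ContDiffOn ℝ 2 (fun p : ℝ × ℝ => u p.1 p.2) (Set.univ ×ˢ Set.Icc 0 T))
    (hunn : ∀ x t : ℝ, t ∈ Set.Icc 0 T → 0 ≤ u x t)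
    (hK : ∃ K : Set ℝ, IsCompact K ∧ ∀ x ∉ K, ∀ t ∈ Set.Icc 0 T, u x t = 0)
    (heq : ∀ x t : ℝ, t ∈ Set.Ioo 0 T →
      deriv (fun s => u x s) t
        = deriv (fun y => deriv (fun z => b (u z t)) y + deriv V y * u y t) x) :
    ∀ p : ℝ, 2 ≤ p →
      (∫ x : ℝ, u x T ^ p) ≤ Real.exp (c * (p - 1) * T) * ∫ x : ℝ, u x 0 ^ p := by
  intro p hp
  obtain ⟨K, hKc, hK0⟩ := hK
  obtain ⟨R, hR, hKR⟩ : ∃ R : ℝ, 0 < R ∧ K ⊆ Ioo (-R) R := by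
    obtain ⟨r, hr⟩ := hKc.isBounded.subset_ball (0 : ℝ)
    refine ⟨max r 1, by positivity, fun x hx => ?_⟩
    have h1 := hr hx
    rw [Metric.mem_ball, Real.dist_eq, sub_zero] at h1
    have h2 := lt_of_lt_of_le h1 (le_max_left r 1)
    exact abs_lt.1 h2
  have hz : ∀ x, x ∉ Ioo (-R) R → ∀ t ∈ Icc 0 T, u x t = 0 := fun x hx t ht =>
    hK0 x (fun h => hx (hKR h)) t ht
  have hfull : ∀ t ∈ Icc 0 T, (∫ x : ℝ, u x t ^ p) = ∫ x in (-R)..R, u x t ^ p := by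
    intro t ht
    symm
    apply intervalIntegral.integral_eq_integral_of_support_subset
    intro x hx
    by_contra hcon
    apply hx
    have : u x t = 0 := hz x (fun h => hcon ⟨h.1, h.2.le⟩) t ht
    simp only [this]
    exact Real.zero_rpow (by linarith)
  set U : ℝ × ℝ → ℝ := fun q => u q.1 q.2 with hU
  have hΩ : IsOpen ((univ : Set ℝ) ×ˢ Ioo 0 T) := isOpen_univ.prod isOpen_Ioo
  have hUΩ : ContDiffOn ℝ 2 U (univ ×ˢ Ioo 0 T) :=
    hureg.mono (prod_mono le_rfl Ioo_subset_Icc_self)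
  have hUat : ∀ x t, t ∈ Ioo 0 T → ContDiffAt ℝ 2 U (x, t) := fun x t ht =>
    hUΩ.contDiffAt (hΩ.mem_nhds ⟨mem_univ _, ht⟩)
  have hslice : ∀ t ∈ Ioo 0 T, ContDiff ℝ 2 (fun x => u x t) := by
    intro t ht
    rw [contDiff_iff_contDiffAt]
    intro x
    exact (hUat x t ht).comp x (contDiffAt_id.prodMk contDiffAt_const)
  set cl : ℝ → ℝ := fun t => max 0 (min T t) with hcl
  have hclC : Continuous cl := by fun_prop
  have hclmem : ∀ t, cl t ∈ Icc 0 T := fun t =>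
    ⟨le_max_left _ _, max_le hT.le (min_le_left _ _)⟩
  have hclid : ∀ t ∈ Icc 0 T, cl t = t := by
    intro t ht
    simp only [hcl, min_eq_right ht.2, max_eq_right ht.1]
  have hFC : Continuous (fun t => ∫ x in (-R)..R, u x (cl t) ^ p) := by
    apply intervalIntegral.continuous_parametric_intervalIntegral_of_continuous'
    have h1 : Continuous (fun q : ℝ × ℝ => U (q.2, cl q.1)) :=
      hureg.continuousOn.comp_continuous (by fun_prop) (fun q => ⟨mem_univ _, hclmem _⟩)
    exact h1.rpow_const (fun _ => Or.inr (by linarith))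
  have hdt : ∀ x t, t ∈ Ioo 0 T → HasDerivAt (fun s => u x s) (fderiv ℝ U (x, t) (0, 1)) t := by
    intro x t ht
    have h1 := ((hUat x t ht).differentiableAt (by norm_num)).hasFDerivAt
    have h2 : HasDerivAt (fun s : ℝ => (x, s)) ((0 : ℝ), (1 : ℝ)) t :=
      (hasDerivAt_const t x).prodMk (hasDerivAt_id t)
    exact h1.comp_hasDerivAt t h2
  have hDC : ContinuousOn (fun q : ℝ × ℝ => fderiv ℝ U q (0, 1) * p * U q ^ (p - 1))
      (univ ×ˢ Ioo 0 T) := by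
    have h1 : ContinuousOn (fderiv ℝ U) (univ ×ˢ Ioo 0 T) :=
      hUΩ.continuousOn_fderiv_of_isOpen hΩ (by norm_num)
    have h2 : ContinuousOn (fun q => fderiv ℝ U q ((0 : ℝ), (1 : ℝ))) (univ ×ˢ Ioo 0 T) :=
      h1.clm_apply continuousOn_const
    exact (h2.mul continuousOn_const).mul
      (hUΩ.continuousOn.rpow_const (fun _ _ => Or.inr (by linarith)))
  have hder : ∀ t ∈ Ioo 0 T, HasDerivAt (fun s => ∫ x in (-R)..R, u x s ^ p)
      (∫ x in (-R)..R, fderiv ℝ U (x, t) (0, 1) * p * u x t ^ (p - 1)) t := by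
    intro t ht
    obtain ⟨l, r, htlr, hnhds, hlr⟩ := exists_Icc_mem_subset_of_mem_nhds
      (isOpen_Ioo.mem_nhds ht)
    obtain ⟨C, hC⟩ := ((isCompact_Icc (a := -R) (b := R)).prod
      (isCompact_Icc (a := l) (b := r))).exists_bound_of_continuousOn
      (hDC.mono (prod_mono (subset_univ _) hlr))
    have hpc : ∀ s ∈ Ioo 0 T, Continuous (fun x => u x s ^ p) := fun s hs =>
      (hslice s hs).continuous.rpow_const (fun _ => Or.inr (by linarith))
    have hFc : Continuous (fun x => fderiv ℝ U (x, t) (0, 1) * p * u x t ^ (p - 1)) :=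
      hDC.comp_continuous (f := fun x : ℝ => (x, t)) (by fun_prop) (fun x => ⟨mem_univ _, ht⟩)
    refine (intervalIntegral.hasDerivAt_integral_of_dominated_loc_of_deriv_le
      (F := fun s x => u x s ^ p)
      (F' := fun s x => fderiv ℝ U (x, s) (0, 1) * p * u x s ^ (p - 1))
      (bound := fun _ => C) hnhds ?_ ?_ ?_ ?_ ?_ ?_).2
    · filter_upwards [isOpen_Ioo.mem_nhds ht] with s hs
      exact (hpc s hs).aestronglyMeasurable
    · exact (hpc t ht).intervalIntegrable _ _
    · exact hFc.aestronglyMeasurable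
    · refine Eventually.of_forall (fun x hx s hs => ?_)
      rw [uIoc_of_le (by linarith)] at hx
      exact hC (x, s) ⟨Ioc_subset_Icc_self hx, hs⟩
    · exact intervalIntegrable_const
    · refine Eventually.of_forall (fun x hx s hs => ?_)
      exact (hdt x s (hlr hs)).rpow_const (Or.inr (by linarith))
  set a : ℝ := c * (p - 1) with ha
  have hder2 : ∀ t ∈ Ioo 0 T, ∃ D, D ≤ a * (∫ x in (-R)..R, u x (cl t) ^ p) ∧
      HasDerivAt (fun s => ∫ x in (-R)..R, u x (cl s) ^ p) D t := by
    intro t ht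
    refine ⟨_, ?_, (hder t ht).congr_of_eventuallyEq ?_⟩
    · rw [hclid t (Ioo_subset_Icc_self ht)]
      have h := slice_ineq b V (fun x => u x t) c hb hbmono hV hVpp (hslice t ht)
        (fun x => hunn x t (Ioo_subset_Icc_self ht)) R hR.le
        (hz R (fun h => lt_irrefl _ h.2) t (Ioo_subset_Icc_self ht))
        (hz (-R) (fun h => lt_irrefl _ h.1) t (Ioo_subset_Icc_self ht)) p hp
      refine le_trans (le_of_eq ?_) h
      congr 1
      funext x
      rw [← heq x t ht, (hdt x t ht).deriv]
    · filter_upwards [isOpen_Ioo.mem_nhds ht] with s hs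
      rw [hclid s (Ioo_subset_Icc_self hs)]
  have hE : ∀ t, HasDerivAt (fun s : ℝ => Real.exp (-a * s)) (Real.exp (-a * t) * -a) t := by
    intro t
    simpa using ((hasDerivAt_id t).const_mul (-a)).exp
  have hanti : AntitoneOn (fun t => Real.exp (-a * t) * ∫ x in (-R)..R, u x (cl t) ^ p)
      (Icc 0 T) := by
    apply antitoneOn_of_deriv_nonpos (convex_Icc 0 T)
    · exact (Continuous.mul (by fun_prop) hFC).continuousOn
    · rw [interior_Icc]
      intro t ht
      obtain ⟨D, _, hD⟩ := hder2 t ht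
      exact ((hE t).mul hD).differentiableAt.differentiableWithinAt
    · rw [interior_Icc]
      intro t ht
      obtain ⟨D, hD1, hD⟩ := hder2 t ht
      have h1 := ((hE t).mul hD).deriv
      refine le_trans (le_of_eq h1) ?_
      nlinarith [mul_le_mul_of_nonneg_left hD1 (Real.exp_pos (-a * t)).le]
  have hfin := hanti (left_mem_Icc.2 hT.le) (right_mem_Icc.2 hT.le) hT.le
  simp only [hclid 0 (left_mem_Icc.2 hT.le), hclid T (right_mem_Icc.2 hT.le), mul_zero,
    Real.exp_zero, one_mul] at hfin
  rw [hfull T (right_mem_Icc.2 hT.le), hfull 0 (left_mem_Icc.2 hT.le)]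
  have h3 := mul_le_mul_of_nonneg_left hfin (Real.exp_pos (a * T)).le
  rw [← mul_assoc, ← Real.exp_add] at h3
  simpa using h3
end

section
/- Lower semicontinuity of the entropy functional F along sequences converging in the sense of (2.14): if (ρ_n) and ρ are finite nonnegative Borel measures on ℝ with ρ_n(ℝ) = ρ(ℝ) = m, all with finite second moment, and ∫_ℝ φ dρ_n → ∫_ℝ φ dρ for every continuous φ : ℝ → ℝ with sup_x |φ(x)|/(1+x²) < +∞, then F(ρ) ≤ liminf_{n→∞} F(ρ_n). -/
open MeasureTheory Set Filter Topology
open scoped ENNReal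

noncomputable def Hs (μ : Measure ℝ) (s : ℝ) : ℝ≥0∞ :=
  ∫⁻ x, ENNReal.ofReal (min s (μ.rnDeriv volume x).toReal)

lemma Hs_le (μ : Measure ℝ) (s : ℝ) {A : Set ℝ} (hA : MeasurableSet A) :
    Hs μ s ≤ μ A + ENNReal.ofReal s * volume Aᶜ := by
  unfold Hs
  rw [← lintegral_add_compl _ hA]
  refine add_le_add ?_ ?_
  · refine le_trans (lintegral_mono fun x => ?_) (Measure.setLIntegral_rnDeriv_le (μ := μ) (ν := volume) A)
    exact (ENNReal.ofReal_le_ofReal (min_le_right _ _)).trans ENNReal.ofReal_toReal_le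
  · rw [← setLIntegral_const]
    exact lintegral_mono fun x => ENNReal.ofReal_le_ofReal (min_le_left _ _)

lemma Hs_opt (μ : Measure ℝ) [IsFiniteMeasure μ] (s : ℝ) :
    ∃ B : Set ℝ, MeasurableSet B ∧ μ B + ENNReal.ofReal s * volume Bᶜ ≤ Hs μ s := by
  obtain ⟨N, hN, h1, h2⟩ := Measure.mutuallySingular_singularPart μ volume
  have hum : Measurable (fun x => (μ.rnDeriv volume x).toReal) :=
    (Measure.measurable_rnDeriv μ volume).ennreal_toReal
  set T : Set ℝ := {x | (μ.rnDeriv volume x).toReal ≤ s} with hT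
  have hTm : MeasurableSet T := measurableSet_le hum measurable_const
  refine ⟨T ∩ N, hTm.inter hN, ?_⟩
  have e1 : μ (T ∩ N) = ∫⁻ x in T ∩ N, μ.rnDeriv volume x := by
    conv_lhs => rw [Measure.haveLebesgueDecomposition_add μ volume]
    rw [Measure.add_apply, withDensity_apply _ (hTm.inter hN),
      measure_mono_null inter_subset_right h1, zero_add]
  unfold Hs
  rw [← lintegral_add_compl _ (hTm.inter hN), e1]
  refine add_le_add ?_ ?_
  · refine lintegral_mono_ae ?_
    filter_upwards [ae_restrict_mem (hTm.inter hN),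
      ae_restrict_of_ae (Measure.rnDeriv_lt_top μ volume)] with x hx hx2
    rw [min_eq_right hx.1, ENNReal.ofReal_toReal hx2.ne]
  · have : volume (T ∩ N)ᶜ = volume Tᶜ := by
      refine le_antisymm ?_ (measure_mono (compl_subset_compl.2 inter_subset_left))
      rw [compl_inter]
      exact (measure_union_le _ _).trans (by rw [h2, add_zero])
    rw [this, ← setLIntegral_const]
    refine le_trans ?_ (lintegral_mono_set (compl_subset_compl.2 inter_subset_left))
    refine lintegral_mono_ae ?_
    filter_upwards [ae_restrict_mem hTm.compl] with x hx
    have : s ≤ (μ.rnDeriv volume x).toReal := le_of_lt (not_le.1 (fun h => hx h))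
    rw [min_eq_left this]

lemma Hs_limsup (ρn : ℕ → Measure ℝ) (ρ : Measure ℝ) [IsFiniteMeasure ρ]
    (hF : ∀ F : Set ℝ, IsClosed F → limsup (fun n => ρn n F) atTop ≤ ρ F) (s : ℝ) (hs : 0 < s) :
    limsup (fun n => Hs (ρn n) s) atTop ≤ Hs ρ s := by
  obtain ⟨B, hB, hBle⟩ := Hs_opt ρ s
  refine le_trans ?_ hBle
  have hs0 : ENNReal.ofReal s ≠ 0 := by simpa using hs
  by_cases hfin : volume Bᶜ = ⊤
  · rw [hfin, ENNReal.mul_top hs0]; simp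
  refine ENNReal.le_of_forall_pos_le_add fun ε hε _ => ?_
  have hε' : (ε : ℝ≥0∞) / ENNReal.ofReal s ≠ 0 :=
    (ENNReal.div_pos (by simpa using hε.ne') ENNReal.ofReal_ne_top).ne'
  obtain ⟨U, hU, hUo, hUv⟩ := Bᶜ.exists_isOpen_lt_add hfin hε'
  have key : ∀ n, Hs (ρn n) s ≤ ρn n Uᶜ + ENNReal.ofReal s * volume U := fun n => by
    simpa using Hs_le (ρn n) s hUo.measurableSet.compl
  have hUfin : ENNReal.ofReal s * volume U ≠ ⊤ :=
    ENNReal.mul_ne_top ENNReal.ofReal_ne_top hUv.ne_top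
  calc limsup (fun n => Hs (ρn n) s) atTop
      ≤ limsup (fun n => ρn n Uᶜ + ENNReal.ofReal s * volume U) atTop :=
        limsup_le_limsup (Eventually.of_forall key)
    _ = limsup (fun n => ρn n Uᶜ) atTop + ENNReal.ofReal s * volume U :=
        limsup_add_const atTop _ _ (by isBoundedDefault) (by isBoundedDefault)
    _ ≤ ρ Uᶜ + ENNReal.ofReal s * (volume Bᶜ + ε / ENNReal.ofReal s) := by
        gcongr
        exact hF _ hUo.isClosed_compl
    _ ≤ ρ B + ENNReal.ofReal s * volume Bᶜ + ε := by
        rw [mul_add, ENNReal.mul_div_cancel hs0 ENNReal.ofReal_ne_top, ← add_assoc]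
        gcongr
        exact compl_subset_comm.1 hU

lemma Hs_tail (μ : Measure ℝ) (M : ℝ) (hM0 : 0 ≤ M)
    (hM : ∫⁻ x, ENNReal.ofReal (x ^ 2) ∂μ ≤ ENNReal.ofReal M) (s : ℝ) (hs : 0 < s) (hs1 : s ≤ 1) :
    Hs μ s ≤ ENNReal.ofReal ((M + 2) * s ^ (1 / 2 : ℝ)) := by
  set R : ℝ := s ^ (-(1 / 2) : ℝ) with hR
  have hRpos : 0 < R := Real.rpow_pos_of_pos hs _
  have hsR : s * R = s ^ (1 / 2 : ℝ) := by
    rw [hR]; nth_rewrite 1 [← Real.rpow_one s]; rw [← Real.rpow_add hs]; norm_num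
  have hsR2 : s * (R ^ 2) = 1 := by
    rw [hR, ← Real.rpow_natCast, ← Real.rpow_mul hs.le]
    nth_rewrite 1 [← Real.rpow_one s]; rw [← Real.rpow_add hs]; norm_num
  have hss : s ≤ s ^ (1 / 2 : ℝ) := by
    nth_rewrite 1 [← Real.rpow_one s]
    exact Real.rpow_le_rpow_of_exponent_ge hs hs1 (by norm_num)
  have hA : MeasurableSet (Icc (-R) R) := measurableSet_Icc
  have h := Hs_le μ s hA.compl
  rw [compl_compl, Real.volume_Icc] at h
  have hmk : μ (Icc (-R) R)ᶜ ≤ ENNReal.ofReal (M * s) := by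
    have h2 := mul_meas_ge_le_lintegral (μ := μ) (f := fun x : ℝ => ENNReal.ofReal (x ^ 2))
      (by fun_prop) (ENNReal.ofReal (R ^ 2))
    have h3 : μ (Icc (-R) R)ᶜ ≤ μ {x | ENNReal.ofReal (R ^ 2) ≤ ENNReal.ofReal (x ^ 2)} := by
      refine measure_mono fun x hx => ?_
      have hx' : ¬ |x| ≤ R := fun h => hx (abs_le.1 h)
      refine ENNReal.ofReal_le_ofReal ?_
      rw [← sq_abs x]
      exact pow_le_pow_left₀ hRpos.le (not_le.1 hx').le 2
    calc μ (Icc (-R) R)ᶜ ≤ μ {x | ENNReal.ofReal (R ^ 2) ≤ ENNReal.ofReal (x ^ 2)} := h3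
      _ = ENNReal.ofReal s * (ENNReal.ofReal (R ^ 2) *
            μ {x | ENNReal.ofReal (R ^ 2) ≤ ENNReal.ofReal (x ^ 2)}) := by
          rw [← mul_assoc, ← ENNReal.ofReal_mul hs.le, hsR2, ENNReal.ofReal_one, one_mul]
      _ ≤ ENNReal.ofReal s * ENNReal.ofReal M := by gcongr; exact h2.trans hM
      _ = _ := by rw [← ENNReal.ofReal_mul hs.le, mul_comm]
  refine h.trans ((add_le_add_left hmk _).trans ?_)
  rw [← ENNReal.ofReal_mul hs.le, ← ENNReal.ofReal_add (by positivity) (by nlinarith)]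
  refine ENNReal.ofReal_le_ofReal ?_
  have : s * (R - -R) = 2 * s ^ (1 / 2 : ℝ) := by rw [← hsR]; ring
  nlinarith

lemma beta_deriv_nonneg (β : ℝ → ℝ) (hβmono : StrictMonoOn β (Set.Ici 0)) {s : ℝ} (hs : 0 < s) :
    0 ≤ deriv β s := by
  have h : MonotoneOn β (Ioi 0) := (hβmono.monotoneOn).mono Ioi_subset_Ici_self
  rw [← derivWithin_of_isOpen isOpen_Ioi (mem_Ioi.2 hs)]
  exact h.derivWithin_nonneg

lemma beta_integrable (β : ℝ → ℝ) (βinf : ℝ)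
    (hβ : ContDiff ℝ 1 β) (hβmono : StrictMonoOn β (Set.Ici 0))
    (hβlim : Tendsto β atTop (𝓝 βinf)) (r : ℝ) (hr : 0 ≤ r) :
    IntegrableOn (deriv β) (Ioi r) :=
  integrableOn_Ioi_deriv_of_nonneg' (fun x _ => (hβ.differentiable (by norm_num) x).hasDerivAt)
    (fun _ hx => beta_deriv_nonneg β hβmono (hr.trans_lt hx)) hβlim

lemma Edens_formula (β : ℝ → ℝ) (βinf : ℝ)
    (hβ : ContDiff ℝ 1 β) (hβmono : StrictMonoOn β (Set.Ici 0)) (hβ0 : β 0 = 0)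
    (hβlim : Tendsto β atTop (𝓝 βinf)) (r : ℝ) (hr : 0 ≤ r) :
    ENNReal.ofReal (-(Edens β r)) =
      ∫⁻ s in Ioi 0, ENNReal.ofReal (min s r) * ENNReal.ofReal (deriv β s / s) := by
  have hpos : ∀ s, 0 < s → 0 ≤ deriv β s := fun s hs => beta_deriv_nonneg β hβmono hs
  rcases hr.eq_or_lt with rfl | hr
  · have : ∫⁻ s in Ioi (0:ℝ), ENNReal.ofReal (min s 0) * ENNReal.ofReal (deriv β s / s) = 0 := by
      rw [← lintegral_zero (μ := volume.restrict (Ioi (0:ℝ)))]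
      refine setLIntegral_congr_fun measurableSet_Ioi fun s hs => ?_
      simp [min_eq_right (le_of_lt (mem_Ioi.1 hs))]
    rw [this]; simp [Edens, hβ0]
  have hc : Continuous (deriv β) := hβ.continuous_deriv (by norm_num)
  have hint := beta_integrable β βinf hβ hβmono hβlim r hr.le
  have hintd : IntegrableOn (fun s => deriv β s / s) (Ioi r) := by
    refine Integrable.mono' (hint.div_const r)
      (hc.measurable.div measurable_id).aestronglyMeasurable ?_
    filter_upwards [ae_restrict_mem measurableSet_Ioi] with s hs
    have hs' : r < s := hs
    have h0 := hpos s (hr.trans hs')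
    rw [Real.norm_of_nonneg (div_nonneg h0 (hr.trans hs').le)]
    exact div_le_div_of_nonneg_left h0 hr hs'.le
  have h1 : ∫⁻ s in Ioc 0 r, ENNReal.ofReal (min s r) * ENNReal.ofReal (deriv β s / s)
      = ENNReal.ofReal (β r) := by
    have e : β r = ∫ s in Ioc 0 r, deriv β s := by
      rw [← intervalIntegral.integral_of_le hr.le,
        intervalIntegral.integral_deriv_eq_sub (fun x _ => hβ.differentiable (by norm_num) x)
          (hc.intervalIntegrable _ _), hβ0, sub_zero]
    rw [e, ofReal_integral_eq_lintegral_ofReal]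
    · refine setLIntegral_congr_fun measurableSet_Ioc fun s hs => ?_
      rw [min_eq_left hs.2, ← ENNReal.ofReal_mul hs.1.le, mul_div_cancel₀ _ hs.1.ne']
    · exact (hc.intervalIntegrable 0 r).1
    · filter_upwards [ae_restrict_mem measurableSet_Ioc] with s hs using hpos s hs.1
  have h2 : ∫⁻ s in Ioi r, ENNReal.ofReal (min s r) * ENNReal.ofReal (deriv β s / s)
      = ENNReal.ofReal (r * ∫ s in Ioi r, deriv β s / s) := by
    rw [ENNReal.ofReal_mul hr.le, ofReal_integral_eq_lintegral_ofReal hintd,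
      ← lintegral_const_mul' _ _ ENNReal.ofReal_ne_top]
    · refine setLIntegral_congr_fun measurableSet_Ioi fun s hs => ?_
      rw [min_eq_right (le_of_lt hs)]
    · filter_upwards [ae_restrict_mem measurableSet_Ioi] with s hs
      exact div_nonneg (hpos s (hr.trans hs)) (hr.trans hs).le
  rw [← Ioc_union_Ioi_eq_Ioi hr.le, lintegral_union measurableSet_Ioi
    (Set.Ioc_disjoint_Ioi le_rfl), h1, h2, ← ENNReal.ofReal_add]
  · congr 1; unfold Edens; ring
  · rw [← hβ0]; exact hβmono.monotoneOn (by simp) hr.le hr.le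
  · refine mul_nonneg hr.le (setIntegral_nonneg measurableSet_Ioi fun s hs => ?_)
    exact div_nonneg (hpos s (hr.trans hs)) (hr.trans hs).le

noncomputable def Jent (β : ℝ → ℝ) (μ : Measure ℝ) : ℝ≥0∞ :=
  ∫⁻ x, ENNReal.ofReal (-(Edens β ((μ.rnDeriv volume x).toReal)))

lemma aux_meas (μ : Measure ℝ) : Measurable (fun p : ℝ × ℝ =>
    ENNReal.ofReal (min p.1 (μ.rnDeriv volume p.2).toReal)) := by
  have := (Measure.measurable_rnDeriv μ volume).ennreal_toReal
  fun_prop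

lemma Hs_meas (μ : Measure ℝ) : Measurable (Hs μ) :=
  (aux_meas μ).lintegral_prod_right'

lemma K_meas (β : ℝ → ℝ) : Measurable (fun s => ENNReal.ofReal (deriv β s / s)) := by
  have := measurable_deriv β
  fun_prop

lemma Jent_eq (β : ℝ → ℝ) (βinf : ℝ)
    (hβ : ContDiff ℝ 1 β) (hβmono : StrictMonoOn β (Set.Ici 0)) (hβ0 : β 0 = 0)
    (hβlim : Tendsto β atTop (𝓝 βinf)) (μ : Measure ℝ) :
    Jent β μ = ∫⁻ s in Ioi 0, Hs μ s * ENNReal.ofReal (deriv β s / s) := by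
  unfold Jent
  simp_rw [fun x => Edens_formula β βinf hβ hβmono hβ0 hβlim (μ.rnDeriv volume x).toReal
    ENNReal.toReal_nonneg]
  rw [lintegral_lintegral_swap]
  · refine lintegral_congr fun s => ?_
    rw [lintegral_mul_const' _ _ ENNReal.ofReal_ne_top]; rfl
  · refine Measurable.aemeasurable ?_
    exact ((aux_meas μ).comp measurable_swap).mul ((K_meas β).comp measurable_snd)

lemma dom_exists (β : ℝ → ℝ) (βinf : ℝ)
    (hβ : ContDiff ℝ 1 β) (hβmono : StrictMonoOn β (Set.Ici 0))
    (hβlim : Tendsto β atTop (𝓝 βinf)) (m M : ℝ) (hm : 0 < m) (hM0 : 0 ≤ M) :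
    ∃ g : ℝ → ℝ≥0∞, ∫⁻ s in Ioi 0, g s ≠ ⊤ ∧ ∀ μ : Measure ℝ, μ univ = ENNReal.ofReal m →
      ∫⁻ x, ENNReal.ofReal (x ^ 2) ∂μ ≤ ENNReal.ofReal M →
      (fun s => Hs μ s * ENNReal.ofReal (deriv β s / s)) ≤ᵐ[volume.restrict (Ioi 0)] g := by
  have hc : Continuous (deriv β) := hβ.continuous_deriv (by norm_num)
  have hpos : ∀ s, 0 < s → 0 ≤ deriv β s := fun s hs => beta_deriv_nonneg β hβmono hs
  obtain ⟨B, hB⟩ := (isCompact_Icc (a := (0:ℝ)) (b := 1)).exists_bound_of_continuousOn hc.continuousOn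
  refine ⟨fun s => (Ioc (0:ℝ) 1).indicator
      (fun s => ENNReal.ofReal ((M + 2) * B * s ^ (-(1 / 2) : ℝ))) s
      + ENNReal.ofReal (m * deriv β s), ?_, ?_⟩
  · rw [lintegral_add_right _ (by fun_prop), lintegral_indicator measurableSet_Ioc]
    refine ENNReal.add_ne_top.2 ⟨?_, ?_⟩
    · rw [Measure.restrict_restrict measurableSet_Ioc, inter_eq_left.2 Ioc_subset_Ioi_self]
      have : IntegrableOn (fun s : ℝ => (M + 2) * B * s ^ (-(1 / 2) : ℝ)) (Ioc 0 1) :=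
        ((intervalIntegral.intervalIntegrable_rpow' (a := 0) (b := 1)
          (by norm_num : (-1:ℝ) < -(1/2))).const_mul _).1
      exact this.lintegral_lt_top.ne
    · exact (((beta_integrable β βinf hβ hβmono hβlim 0 le_rfl).const_mul m).lintegral_lt_top).ne
  · intro μ hμ hμM
    filter_upwards [ae_restrict_mem measurableSet_Ioi] with s hs
    have hs : 0 < s := hs
    have hd := hpos s hs
    by_cases h1 : s ≤ 1
    · rw [indicator_of_mem (show s ∈ Ioc (0:ℝ) 1 from ⟨hs, h1⟩)]
      refine le_trans (mul_le_mul_left (Hs_tail μ M hM0 hμM s hs h1) _) (le_trans ?_ le_self_add)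
      rw [← ENNReal.ofReal_mul (by positivity)]
      refine ENNReal.ofReal_le_ofReal ?_
      have hb : deriv β s ≤ B := (le_abs_self _).trans (hB s ⟨hs.le, h1⟩)
      have e : s ^ (-(1 / 2) : ℝ) = s ^ (1 / 2 : ℝ) / s := by
        rw [← Real.rpow_sub_one hs.ne']; norm_num
      rw [e]
      calc (M + 2) * s ^ (1 / 2 : ℝ) * (deriv β s / s)
          = (M + 2) * deriv β s * (s ^ (1 / 2 : ℝ) / s) := by ring
        _ ≤ _ := by gcongr
    · rw [indicator_of_notMem (fun h => h1 h.2), zero_add, ENNReal.ofReal_mul hm.le]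
      have := Hs_le μ s MeasurableSet.univ
      simp only [compl_univ, measure_empty, mul_zero, add_zero, hμ] at this
      refine mul_le_mul' this (ENNReal.ofReal_le_ofReal ?_)
      exact div_le_self hd (not_le.1 h1).le

lemma quad_int (μ : Measure ℝ) [IsFiniteMeasure μ]
    (hmom : (∫⁻ x, ENNReal.ofReal (x ^ 2) ∂μ) < ⊤) (φ : ℝ → ℝ) (hφ : Continuous φ)
    (C : ℝ) (hC : ∀ x : ℝ, |φ x| ≤ C * (1 + x ^ 2)) : Integrable φ μ := by
  have h2 : Integrable (fun x : ℝ => x ^ 2) μ := by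
    refine ⟨by fun_prop, ?_⟩
    rw [hasFiniteIntegral_iff_ofReal (Eventually.of_forall fun x => sq_nonneg x)]
    exact hmom
  exact Integrable.mono' (((integrable_const 1).add h2).const_mul C) hφ.aestronglyMeasurable
    (Eventually.of_forall hC)

lemma tendsto_lint (ρn : ℕ → Measure ℝ) (ρ : Measure ℝ)
    (hρnfin : ∀ n, IsFiniteMeasure (ρn n)) (hρfin : IsFiniteMeasure ρ)
    (hρnmom : ∀ n, (∫⁻ x, ENNReal.ofReal (x ^ 2) ∂(ρn n)) < ⊤)
    (hρmom : (∫⁻ x, ENNReal.ofReal (x ^ 2) ∂ρ) < ⊤)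
    (hconv : ∀ φ : ℝ → ℝ, Continuous φ → (∃ C : ℝ, ∀ x : ℝ, |φ x| ≤ C * (1 + x ^ 2)) →
      Tendsto (fun n => ∫ x, φ x ∂(ρn n)) atTop (𝓝 (∫ x, φ x ∂ρ)))
    (φ : ℝ → ℝ) (hφ : Continuous φ) (h0 : ∀ x, 0 ≤ φ x)
    (C : ℝ) (hC : ∀ x : ℝ, |φ x| ≤ C * (1 + x ^ 2)) :
    Tendsto (fun n => ∫⁻ x, ENNReal.ofReal (φ x) ∂(ρn n)) atTop
      (𝓝 (∫⁻ x, ENNReal.ofReal (φ x) ∂ρ)) := by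
  have h := ENNReal.tendsto_ofReal (hconv φ hφ ⟨C, hC⟩)
  rw [ofReal_integral_eq_lintegral_ofReal (quad_int ρ hρmom φ hφ C hC)
    (Eventually.of_forall h0)] at h
  refine h.congr fun n => ?_
  have := hρnfin n
  rw [ofReal_integral_eq_lintegral_ofReal (quad_int _ (hρnmom n) φ hφ C hC)
    (Eventually.of_forall h0)]

lemma Fent_eq_s6 (β V : ℝ → ℝ) (μ : Measure ℝ) (hJ : Jent β μ ≠ ⊤)
    (hQ : ∫⁻ x, ENNReal.ofReal (-(V x)) ∂μ ≠ ⊤) :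
    Fent β V μ = (-(Jent β μ : EReal) + -((∫⁻ x, ENNReal.ofReal (-(V x)) ∂μ : ℝ≥0∞) : EReal))
      + ((∫⁻ x, ENNReal.ofReal (V x) ∂μ : ℝ≥0∞) : EReal) := by
  change (if (∫⁻ x, ENNReal.ofReal (V x) ∂μ) = ⊤ then ⊤
  else (-(Jent β μ : EReal)) + erealInt V μ) = _
  unfold erealInt
  generalize Jent β μ = J at *
  generalize (∫⁻ x, ENNReal.ofReal (-(V x)) ∂μ) = Q at *
  generalize (∫⁻ x, ENNReal.ofReal (V x) ∂μ) = P at *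
  lift J to NNReal using hJ
  lift Q to NNReal using hQ
  split_ifs with h
  · subst h
    rw [EReal.coe_ennreal_top, EReal.add_top_of_ne_bot]
    change (-(((J : ℝ) : EReal)) + -(((Q : ℝ) : EReal))) ≠ ⊥
    rw [← EReal.coe_neg, ← EReal.coe_neg, ← EReal.coe_add]
    exact EReal.coe_ne_bot _
  · rw [sub_eq_add_neg, add_assoc, add_comm (P : EReal)]

lemma neg_limsup_le (u : ℕ → ℝ≥0∞) (a : ℝ≥0∞) (h : limsup u atTop ≤ a) :
    -(a : EReal) ≤ liminf (fun n => -((u n : ℝ≥0∞) : EReal)) atTop := by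
  have e : limsup (fun n => ((u n : ℝ≥0∞) : EReal)) atTop = ((limsup u atTop : ℝ≥0∞) : EReal) := by
    have := Monotone.map_limsup_of_continuousAt (F := atTop) (f := ((↑) : ℝ≥0∞ → EReal))
      (fun a b hab => EReal.coe_ennreal_le_coe_ennreal_iff.2 hab) u
      continuous_coe_ennreal_ereal.continuousAt
    exact this.symm
  have e2 := EReal.liminf_neg (f := atTop) (v := fun n => ((u n : ℝ≥0∞) : EReal))
  change _ ≤ liminf (-(fun n => ((u n : ℝ≥0∞) : EReal))) atTop
  rw [e2, e]
  exact EReal.neg_le_neg_iff.2 (EReal.coe_ennreal_le_coe_ennreal_iff.2 h)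

lemma le_liminf_coe (u : ℕ → ℝ≥0∞) (a : ℝ≥0∞) (h : a ≤ liminf u atTop) :
    (a : EReal) ≤ liminf (fun n => ((u n : ℝ≥0∞) : EReal)) atTop := by
  have := Monotone.map_liminf_of_continuousAt (F := atTop) (f := ((↑) : ℝ≥0∞ → EReal))
      (fun a b hab => EReal.coe_ennreal_le_coe_ennreal_iff.2 hab) u
      continuous_coe_ennreal_ereal.continuousAt
  exact (EReal.coe_ennreal_le_coe_ennreal_iff.2 h).trans_eq this

lemma closed_le (ρn : ℕ → Measure ℝ) (ρ : Measure ℝ)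
    (hρnfin : ∀ n, IsFiniteMeasure (ρn n)) (hρfin : IsFiniteMeasure ρ)
    (hconv : ∀ φ : ℝ → ℝ, Continuous φ → (∃ C : ℝ, ∀ x : ℝ, |φ x| ≤ C * (1 + x ^ 2)) →
      Tendsto (fun n => ∫ x, φ x ∂(ρn n)) atTop (𝓝 (∫ x, φ x ∂ρ)))
    (F : Set ℝ) (hF : IsClosed F) : limsup (fun n => ρn n F) atTop ≤ ρ F := by
  let νn : ℕ → FiniteMeasure ℝ := fun n => ⟨ρn n, hρnfin n⟩
  let ν : FiniteMeasure ℝ := ⟨ρ, hρfin⟩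
  have hweak : Tendsto νn atTop (𝓝 ν) := by
    rw [FiniteMeasure.tendsto_iff_forall_integral_tendsto]
    intro f
    refine hconv f f.continuous ⟨‖f‖, fun x => ?_⟩
    have h1 : |f x| ≤ ‖f‖ := f.norm_coe_le_norm x
    nlinarith [norm_nonneg f, sq_nonneg x, mul_nonneg (norm_nonneg f) (sq_nonneg x)]
  exact FiniteMeasure.limsup_measure_closed_le_of_tendsto hweak hF

lemma pos_part (V : ℝ → ℝ) (hVc : Continuous V) (ρn : ℕ → Measure ℝ) (ρ : Measure ℝ)
    (hTL : ∀ φ : ℝ → ℝ, Continuous φ → (∀ x, 0 ≤ φ x) → ∀ C : ℝ,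
      (∀ x : ℝ, |φ x| ≤ C * (1 + x ^ 2)) →
      Tendsto (fun n => ∫⁻ x, ENNReal.ofReal (φ x) ∂(ρn n)) atTop
        (𝓝 (∫⁻ x, ENNReal.ofReal (φ x) ∂ρ))) :
    ∫⁻ x, ENNReal.ofReal (V x) ∂ρ ≤
      liminf (fun n => ∫⁻ x, ENNReal.ofReal (V x) ∂(ρn n)) atTop := by
  have hsup : ∀ x, ENNReal.ofReal (V x) = ⨆ k : ℕ, ENNReal.ofReal (min (max (V x) 0) k) := by
    intro x
    refine le_antisymm ?_ (iSup_le fun k => ?_)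
    · obtain ⟨k, hk⟩ := exists_nat_ge (max (V x) 0)
      refine le_trans ?_ (le_iSup _ k)
      rw [min_eq_left hk]
      exact ENNReal.ofReal_le_ofReal (le_max_left _ _)
    · refine (ENNReal.ofReal_le_ofReal (min_le_left _ _)).trans ?_
      simp
  have hmeas : ∀ k : ℕ, Measurable (fun x => ENNReal.ofReal (min (max (V x) 0) (k : ℝ))) :=
    fun k => by fun_prop
  calc ∫⁻ x, ENNReal.ofReal (V x) ∂ρ
      = ⨆ k : ℕ, ∫⁻ x, ENNReal.ofReal (min (max (V x) 0) k) ∂ρ := by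
        simp_rw [hsup]
        refine lintegral_iSup hmeas fun i j hij x => ?_
        refine ENNReal.ofReal_le_ofReal (min_le_min_left _ (by exact_mod_cast hij))
    _ ≤ _ := by
        refine iSup_le fun k => ?_
        have ht := hTL (fun x => min (max (V x) 0) (k : ℝ)) (by fun_prop)
          (fun x => le_min (le_max_right _ _) (Nat.cast_nonneg k)) k (fun x => by
            rw [abs_of_nonneg (le_min (le_max_right _ _) (Nat.cast_nonneg k))]
            refine (min_le_right _ _).trans ?_
            have : (0:ℝ) ≤ k := Nat.cast_nonneg k
            nlinarith [mul_nonneg this (sq_nonneg x)])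
        rw [← ht.liminf_eq]
        refine liminf_le_liminf (Eventually.of_forall fun n => ?_)
        refine lintegral_mono fun x => ?_
        rw [hsup x]
        exact le_iSup (fun k : ℕ => ENNReal.ofReal (min (max (V x) 0) (k : ℝ))) k

/-- lower semicontinuity of the entropy functional `F` along sequences of
measures of mass `m` with finite second moments converging in the duality with
continuous functions of at most quadratic growth. -/
theorem entropy_lower_semicontinuous
    (β V : ℝ → ℝ) (βinf lam : ℝ)
    (hβ : ContDiff ℝ 1 β) (hβmono : StrictMonoOn β (Set.Ici 0)) (hβ0 : β 0 = 0)
    (hβlim : Tendsto β atTop (𝓝 βinf))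
    (hV : ContDiff ℝ 2 V) (hVpp : ∀ x : ℝ, lam ≤ deriv (deriv V) x)
    (hVquad : ∀ δ : ℝ, 0 < δ → ∃ R : ℝ, 0 < R ∧ ∀ x : ℝ, R ≤ |x| → -δ * x ^ 2 ≤ V x)
    (m : ℝ) (hm : 0 < m)
    (ρn : ℕ → Measure ℝ) (ρ : Measure ℝ)
    (hρnfin : ∀ n, IsFiniteMeasure (ρn n)) (hρfin : IsFiniteMeasure ρ)
    (hρnmass : ∀ n, ρn n Set.univ = ENNReal.ofReal m)
    (hρmass : ρ Set.univ = ENNReal.ofReal m)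
    (hρnmom : ∀ n, (∫⁻ x, ENNReal.ofReal (x ^ 2) ∂(ρn n)) < ⊤)
    (hρmom : (∫⁻ x, ENNReal.ofReal (x ^ 2) ∂ρ) < ⊤)
    (hconv : ∀ φ : ℝ → ℝ, Continuous φ → (∃ C : ℝ, ∀ x : ℝ, |φ x| ≤ C * (1 + x ^ 2)) →
      Tendsto (fun n => ∫ x, φ x ∂(ρn n)) atTop (𝓝 (∫ x, φ x ∂ρ))) :
    Fent β V ρ ≤ Filter.liminf (fun n => Fent β V (ρn n)) atTop := by
  have hVc : Continuous V := hV.continuous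
  -- second moments are uniformly bounded
  have hxs : ∀ x : ℝ, |x ^ 2| ≤ 1 * (1 + x ^ 2) := fun x => by
    rw [abs_of_nonneg (sq_nonneg x)]; linarith
  have hTL := tendsto_lint ρn ρ hρnfin hρfin hρnmom hρmom hconv
  obtain ⟨M0, hM0⟩ := (hconv (fun x => x ^ 2) (by fun_prop) ⟨1, hxs⟩).bddAbove_range
  have hmn : ∀ n, ∫⁻ x, ENNReal.ofReal (x ^ 2) ∂(ρn n) ≤ ENNReal.ofReal (max M0 0) := fun n => by
    have := hρnfin n
    rw [← ofReal_integral_eq_lintegral_ofReal (quad_int _ (hρnmom n) _ (by fun_prop) 1 hxs)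
      (Eventually.of_forall fun x => sq_nonneg x)]
    exact ENNReal.ofReal_le_ofReal ((hM0 (mem_range_self n)).trans (le_max_left _ _))
  -- the diffusion part
  obtain ⟨g, hg, hgb⟩ := dom_exists β βinf hβ hβmono hβlim m (max M0 0) hm (le_max_right _ _)
  have hJn : ∀ n, Jent β (ρn n) ≠ ⊤ := fun n => by
    rw [Jent_eq β βinf hβ hβmono hβ0 hβlim]
    exact ((lintegral_mono_ae (hgb _ (hρnmass n) (hmn n))).trans_lt hg.lt_top).ne
  have hJ : Jent β ρ ≠ ⊤ := by
    obtain ⟨g, hg, hgb⟩ := dom_exists β βinf hβ hβmono hβlim m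
      (∫⁻ x, ENNReal.ofReal (x ^ 2) ∂ρ).toReal hm ENNReal.toReal_nonneg
    rw [Jent_eq β βinf hβ hβmono hβ0 hβlim]
    exact ((lintegral_mono_ae (hgb _ hρmass
      (ENNReal.ofReal_toReal hρmom.ne).ge)).trans_lt hg.lt_top).ne
  have hclosed := closed_le ρn ρ hρnfin hρfin hconv
  have hJlim : limsup (fun n => Jent β (ρn n)) atTop ≤ Jent β ρ := by
    simp_rw [Jent_eq β βinf hβ hβmono hβ0 hβlim]
    refine (limsup_lintegral_le g (fun n => (Hs_meas (ρn n)).mul (K_meas β))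
      (fun n => hgb _ (hρnmass n) (hmn n)) hg).trans ?_
    refine lintegral_mono_ae ?_
    filter_upwards [ae_restrict_mem measurableSet_Ioi] with s hs
    have h1 := Hs_limsup ρn ρ hclosed s hs
    have h2 : limsup (fun n => Hs (ρn n) s * ENNReal.ofReal (deriv β s / s)) atTop
        = ENNReal.ofReal (deriv β s / s) * limsup (fun n => Hs (ρn n) s) atTop := by
      rw [← ENNReal.limsup_const_mul_of_ne_top ENNReal.ofReal_ne_top]
      simp_rw [mul_comm]
    refine h2.trans_le ?_
    rw [mul_comm]
    gcongr
  -- the negative part of the potential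
  obtain ⟨R, hR, hRV⟩ := hVquad 1 one_pos
  obtain ⟨B, hB⟩ := (isCompact_Icc (a := -R) (b := R)).exists_bound_of_continuousOn hVc.continuousOn
  have hB0 : 0 ≤ B := (norm_nonneg _).trans (hB 0 ⟨by linarith, hR.le⟩)
  have hneg : ∀ x, |max (-(V x)) 0| ≤ (B + 1) * (1 + x ^ 2) := fun x => by
    rw [abs_of_nonneg (le_max_right _ _)]
    refine max_le ?_ (by positivity)
    rcases le_total R |x| with h | h
    · have := hRV x h
      nlinarith [mul_nonneg hB0 (sq_nonneg x)]
    · have h3 : |V x| ≤ B := hB x (abs_le.1 h)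
      have := neg_abs_le (V x)
      nlinarith [mul_nonneg hB0 (sq_nonneg x), sq_nonneg x]
  have hmaxe : ∀ x, ENNReal.ofReal (max (-(V x)) 0) = ENNReal.ofReal (-(V x)) := fun x => by
    simp
  have hQt := hTL (fun x => max (-(V x)) 0) (by fun_prop) (fun x => le_max_right _ _) (B + 1) hneg
  simp only [hmaxe] at hQt
  have hQf : ∀ μ : Measure ℝ, IsFiniteMeasure μ → (∫⁻ x, ENNReal.ofReal (x ^ 2) ∂μ) < ⊤ →
      ∫⁻ x, ENNReal.ofReal (-(V x)) ∂μ ≠ ⊤ := fun μ h1 h2 => by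
    have := (quad_int μ h2 (fun x => max (-(V x)) 0) (by fun_prop) (B + 1) hneg).lintegral_lt_top
    simp only [hmaxe] at this
    exact this.ne
  -- the positive part
  have hP := pos_part V hVc ρn ρ hTL
  rw [Fent_eq_s6 β V ρ hJ (hQf ρ hρfin hρmom)]
  simp_rw [fun n => Fent_eq_s6 β V (ρn n) (hJn n) (hQf _ (hρnfin n) (hρnmom n))]
  refine le_trans ?_ EReal.le_liminf_add
  refine add_le_add (le_trans ?_ EReal.le_liminf_add) (le_liminf_coe _ _ hP)
  exact add_le_add (neg_limsup_le _ _ hJlim) (neg_limsup_le _ _ hQt.limsup_eq.le)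
end

section
/- Coercivity of the entropy functional: for every m > 0 and C > 0, the infimum of F(ρ) over all finite nonnegative Borel measures ρ on ℝ with ρ(ℝ) = m and second moment ∫_ℝ x² dρ(x) ≤ C is strictly greater than −∞. -/
open MeasureTheory Set Filter Topology
open scoped ENNReal

lemma Edens_bound (β : ℝ → ℝ) (βinf : ℝ)
    (hβ : ContDiff ℝ 1 β) (hβmono : StrictMonoOn β (Set.Ici 0)) (hβ0 : β 0 = 0)
    (hβlim : Tendsto β atTop (𝓝 βinf)) :
    ∃ A : ℝ, 0 ≤ A ∧ ∀ r : ℝ, 0 ≤ r → -(Edens β r) ≤ A * (r + √r) := by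
  have hd : Differentiable ℝ β := hβ.differentiable (by norm_num)
  have hdc : Continuous (deriv β) := hβ.continuous_deriv (by norm_num)
  have hnn : ∀ s : ℝ, 0 < s → 0 ≤ deriv β s := by
    intro s hs
    have h1 : 0 ≤ derivWithin β (Set.Ici 0) s := hβmono.monotoneOn.derivWithin_nonneg
    rwa [derivWithin_of_mem_nhds (Ici_mem_nhds hs)] at h1
  have hle : ∀ s : ℝ, 0 ≤ s → β s ≤ βinf := by
    intro s hs
    refine ge_of_tendsto hβlim ?_
    filter_upwards [eventually_ge_atTop s] with t ht
    exact hβmono.monotoneOn hs (hs.trans ht) ht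
  have hpos : ∀ s : ℝ, 0 ≤ s → 0 ≤ β s := by
    intro s hs
    rw [← hβ0]
    exact hβmono.monotoneOn (by simp) hs hs
  have hinf : 0 ≤ βinf := by have := hle 0 le_rfl; rwa [hβ0] at this
  obtain ⟨K, hK⟩ := (isCompact_Icc (a := (0:ℝ)) (b := 1)).exists_bound_of_continuousOn
    hdc.continuousOn
  have hK0 : 0 ≤ K := (norm_nonneg _).trans (hK 0 (by simp))
  have hlin : ∀ r : ℝ, 0 ≤ r → β r ≤ (K + βinf) * r := by
    intro r hr
    rcases le_total r 1 with h | h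
    · have := (convex_Icc (0:ℝ) 1).norm_image_sub_le_of_norm_deriv_le
        (f := β) (C := K) (fun x _ => hd x) hK (x := 0) (y := r) (by simp) ⟨hr, h⟩
      rw [hβ0, sub_zero, sub_zero, Real.norm_eq_abs, Real.norm_eq_abs, abs_of_nonneg hr] at this
      have h2 := le_abs_self (β r)
      nlinarith [mul_nonneg hinf hr]
    · have h2 := hle r hr
      nlinarith [mul_nonneg hK0 hr]
  refine ⟨K + βinf + βinf + 2 * K, by positivity, ?_⟩
  intro r hr
  rcases hr.eq_or_lt with rfl | hr'
  · simp [Edens, hβ0]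
  have hder : ∀ x ∈ Ioi r, HasDerivAt β (deriv β x) x := fun x _ => (hd x).hasDerivAt
  have hnn' : ∀ x ∈ Ioi r, 0 ≤ deriv β x := fun x hx => hnn x (hr'.trans hx)
  have hi1 : IntegrableOn (deriv β) (Ioi r) :=
    integrableOn_Ioi_deriv_of_nonneg hd.continuous.continuousWithinAt hder hnn' hβlim
  have he1 : ∫ x in Ioi r, deriv β x = βinf - β r :=
    integral_Ioi_of_hasDerivAt_of_nonneg hd.continuous.continuousWithinAt hder hnn' hβlim
  have hi2 : IntegrableOn (fun x : ℝ => x ^ (-(3/2) : ℝ)) (Ioi r) :=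
    integrableOn_Ioi_rpow_of_lt (by norm_num) hr'
  have he2 : ∫ x in Ioi r, x ^ (-(3/2) : ℝ) = 2 * r ^ (-(1/2) : ℝ) := by
    rw [integral_Ioi_rpow_of_lt (by norm_num) hr']
    norm_num
    ring
  have hint : ∫ s in Ioi r, deriv β s / s ≤ K * (2 * r ^ (-(1/2) : ℝ)) + (βinf - β r) := by
    rw [← he1, ← he2, ← integral_const_mul, ← integral_add (hi2.const_mul K) hi1]
    refine integral_mono_of_nonneg ?_ ((hi2.const_mul K).add hi1) ?_
    · filter_upwards [ae_restrict_mem measurableSet_Ioi] with s hs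
      exact div_nonneg (hnn' s hs) (hr'.trans hs).le
    · filter_upwards [ae_restrict_mem measurableSet_Ioi] with s hs
      have hs0 : 0 < s := hr'.trans hs
      have hds := hnn' s hs
      have hp : 0 ≤ s ^ (-(3/2) : ℝ) := Real.rpow_nonneg hs0.le _
      show deriv β s / s ≤ K * s ^ (-(3/2) : ℝ) + deriv β s
      rcases le_total s 1 with h | h
      · have h1 : s⁻¹ ≤ s ^ (-(3/2) : ℝ) := by
          rw [← Real.rpow_neg_one]
          exact Real.rpow_le_rpow_of_exponent_ge hs0 h (by norm_num)
        have h2 : deriv β s ≤ K := (le_abs_self _).trans (hK s ⟨hs0.le, h⟩)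
        have : deriv β s / s ≤ K * s ^ (-(3/2) : ℝ) := by
          rw [div_eq_mul_inv]
          exact mul_le_mul h2 h1 (by positivity) hK0
        linarith
      · have : deriv β s / s ≤ deriv β s := div_le_self hds h
        have := mul_nonneg hK0 hp
        linarith
  have hsq : r * r ^ (-(1/2) : ℝ) = √r := by
    rw [Real.sqrt_eq_rpow]
    nth_rewrite 1 [← Real.rpow_one r]
    rw [← Real.rpow_add hr']
    norm_num
  have h3 := mul_le_mul_of_nonneg_left hint hr
  have h4 : r * (K * (2 * r ^ (-(1/2) : ℝ)) + (βinf - β r))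
      = 2 * K * √r + r * βinf - r * β r := by rw [← hsq]; ring
  have h5 := hlin r hr
  have h6 := mul_nonneg hr (hpos r hr)
  have h7 := mul_nonneg hK0 hr
  have h8 := mul_nonneg hK0 (Real.sqrt_nonneg r)
  have h9 := mul_nonneg hinf (Real.sqrt_nonneg r)
  unfold Edens
  nlinarith

lemma V_bound (V : ℝ → ℝ) (hV : Continuous V)
    (hVquad : ∀ δ : ℝ, 0 < δ → ∃ R : ℝ, 0 < R ∧ ∀ x : ℝ, R ≤ |x| → -δ * x ^ 2 ≤ V x) :
    ∃ D : ℝ, 0 ≤ D ∧ ∀ x, -(V x) ≤ x ^ 2 + D := by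
  obtain ⟨R, hR, h⟩ := hVquad 1 one_pos
  obtain ⟨D, hD⟩ := (isCompact_Icc (a := -R) (b := R)).exists_bound_of_continuousOn
    hV.continuousOn
  have hD0 : 0 ≤ D := (norm_nonneg _).trans (hD 0 ⟨by linarith, hR.le⟩)
  refine ⟨D, hD0, fun x => ?_⟩
  rcases le_total R |x| with h1 | h1
  · have := h x h1
    linarith
  · have := hD x (abs_le.mp h1)
    have h2 := neg_le_abs (V x)
    rw [Real.norm_eq_abs] at this
    nlinarith [sq_nonneg x]

lemma sqrt_young (r x : ℝ) (hr : 0 ≤ r) :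
    r + √r ≤ 2 * ((1 + x ^ 2) * r) + (1 + x ^ 2)⁻¹ := by
  have hw : 0 < 1 + x ^ 2 := by positivity
  have h1 : r ≤ (1 + x ^ 2) * r := by nlinarith [mul_nonneg (sq_nonneg x) hr]
  have h2 : √r ≤ (1 + x ^ 2) * r + (1 + x ^ 2)⁻¹ := by
    have hs := Real.sq_sqrt hr
    have h3 : (1 + x ^ 2) * r + (1 + x ^ 2)⁻¹ - √r
       = (1 + x ^ 2)⁻¹ * (((1 + x ^ 2) * √r - 1/2) ^ 2 + 3/4) := by
      nth_rewrite 1 [← hs]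
      field_simp
      ring
    have : 0 ≤ (1 + x ^ 2)⁻¹ * (((1 + x ^ 2) * √r - 1/2) ^ 2 + 3/4) := by positivity
    linarith
  linarith

/-- coercivity of the entropy functional: for every `m > 0` and `C > 0`,
`F` is bounded from below on finite nonnegative Borel measures of mass `m` whose
second moment is at most `C`. -/
theorem entropy_coercive
    (β V : ℝ → ℝ) (βinf lam : ℝ)
    (hβ : ContDiff ℝ 1 β) (hβmono : StrictMonoOn β (Set.Ici 0)) (hβ0 : β 0 = 0)
    (hβlim : Tendsto β atTop (𝓝 βinf))
    (hV : ContDiff ℝ 2 V) (hVpp : ∀ x : ℝ, lam ≤ deriv (deriv V) x)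
    (hVquad : ∀ δ : ℝ, 0 < δ → ∃ R : ℝ, 0 < R ∧ ∀ x : ℝ, R ≤ |x| → -δ * x ^ 2 ≤ V x)
    (m C : ℝ) (hm : 0 < m) (hC : 0 < C) :
    ∃ B : ℝ, ∀ ρ : Measure ℝ, IsFiniteMeasure ρ → ρ Set.univ = ENNReal.ofReal m →
      (∫⁻ x, ENNReal.ofReal (x ^ 2) ∂ρ) ≤ ENNReal.ofReal C →
      (B : EReal) ≤ Fent β V ρ := by
  obtain ⟨A, hA, hE⟩ := Edens_bound β βinf hβ hβmono hβ0 hβlim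
  obtain ⟨D, hD, hVb⟩ := V_bound V hV.continuous hVquad
  refine ⟨-(A * (2 * (m + C) + Real.pi)) - (C + D * m), ?_⟩
  intro ρ hρ hmass hmom
  unfold Fent
  split_ifs with htop
  · exact le_top
  have hW : ∫⁻ x, ENNReal.ofReal (1 + x ^ 2) ∂ρ ≤ ENNReal.ofReal (m + C) := by
    have : ∀ x : ℝ, ENNReal.ofReal (1 + x ^ 2) = 1 + ENNReal.ofReal (x ^ 2) := by
      intro x
      rw [ENNReal.ofReal_add zero_le_one (sq_nonneg x), ENNReal.ofReal_one]
    simp_rw [this]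
    rw [lintegral_add_left measurable_const, lintegral_one, hmass, ENNReal.ofReal_add hm.le hC.le]
    gcongr
  have hU : ∫⁻ x, ρ.rnDeriv volume x * ENNReal.ofReal (1 + x ^ 2) ≤ ENNReal.ofReal (m + C) := by
    refine le_trans ?_ hW
    have := lintegral_withDensity_eq_lintegral_mul (volume : Measure ℝ)
      (Measure.measurable_rnDeriv ρ volume)
      (g := fun x : ℝ => ENNReal.ofReal (1 + x ^ 2)) (by fun_prop)
    simp only [Pi.mul_apply] at this
    rw [← this]
    exact lintegral_mono' (Measure.withDensity_rnDeriv_le ρ volume) le_rfl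
  have hpi : ∫⁻ x : ℝ, ENNReal.ofReal ((1 + x ^ 2)⁻¹) = ENNReal.ofReal Real.pi := by
    rw [← ofReal_integral_eq_lintegral_ofReal integrable_inv_one_add_sq
      (Eventually.of_forall fun x => by positivity), integral_univ_inv_one_add_sq]
  have h1 : (∫⁻ x, ENNReal.ofReal (-(Edens β ((ρ.rnDeriv volume x).toReal))))
      ≤ ENNReal.ofReal (A * (2 * (m + C) + Real.pi)) := by
    calc (∫⁻ x, ENNReal.ofReal (-(Edens β ((ρ.rnDeriv volume x).toReal))))
        ≤ ∫⁻ x, ENNReal.ofReal A * (2 * (ρ.rnDeriv volume x * ENNReal.ofReal (1 + x ^ 2))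
            + ENNReal.ofReal ((1 + x ^ 2)⁻¹)) := by
          refine lintegral_mono fun x => ?_
          set r := (ρ.rnDeriv volume x).toReal with hrdef
          have hr : 0 ≤ r := ENNReal.toReal_nonneg
          have h := (hE r hr).trans (mul_le_mul_of_nonneg_left (sqrt_young r x hr) hA)
          refine (ENNReal.ofReal_le_ofReal h).trans ?_
          rw [ENNReal.ofReal_mul hA, ENNReal.ofReal_add (by positivity) (by positivity),
            ENNReal.ofReal_mul (by norm_num), mul_comm (1 + x ^ 2) r, ENNReal.ofReal_mul hr,
            ENNReal.ofReal_ofNat]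
          gcongr
          exact ENNReal.ofReal_toReal_le
      _ = ENNReal.ofReal A * (2 * (∫⁻ x, ρ.rnDeriv volume x * ENNReal.ofReal (1 + x ^ 2))
            + ENNReal.ofReal Real.pi) := by
          have hm1 : Measurable fun x => ρ.rnDeriv volume x * ENNReal.ofReal (1 + x ^ 2) :=
            (Measure.measurable_rnDeriv ρ volume).mul (by fun_prop)
          rw [lintegral_const_mul' _ _ ENNReal.ofReal_ne_top,
            lintegral_add_left (hm1.const_mul 2), lintegral_const_mul _ hm1, hpi]
      _ ≤ ENNReal.ofReal A * (2 * ENNReal.ofReal (m + C) + ENNReal.ofReal Real.pi) := by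
          gcongr
      _ = _ := by
          rw [ENNReal.ofReal_mul hA, ENNReal.ofReal_add (by positivity) Real.pi_pos.le,
            ENNReal.ofReal_mul (by norm_num), ENNReal.ofReal_ofNat]
  have h2 : ∫⁻ x, ENNReal.ofReal (-(V x)) ∂ρ ≤ ENNReal.ofReal (C + D * m) := by
    calc ∫⁻ x, ENNReal.ofReal (-(V x)) ∂ρ
        ≤ ∫⁻ x, (ENNReal.ofReal (x ^ 2) + ENNReal.ofReal D) ∂ρ := by
          refine lintegral_mono fun x => ?_
          rw [← ENNReal.ofReal_add (sq_nonneg x) hD]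
          exact ENNReal.ofReal_le_ofReal (hVb x)
      _ ≤ ENNReal.ofReal C + ENNReal.ofReal D * ENNReal.ofReal m := by
          rw [lintegral_add_right _ measurable_const, lintegral_const, hmass]
          gcongr
      _ = _ := by
          rw [ENNReal.ofReal_add hC.le (by positivity), ENNReal.ofReal_mul hD]
  have key : ∀ (I : ℝ≥0∞) (t : ℝ), 0 ≤ t → I ≤ ENNReal.ofReal t →
      ((-t : ℝ) : EReal) ≤ -(I : EReal) := by
    intro I t ht h
    rw [EReal.coe_neg, EReal.neg_le_neg_iff]
    have h' := EReal.coe_ennreal_le_coe_ennreal_iff.mpr h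
    rwa [EReal.coe_ennreal_ofReal, max_eq_left ht] at h'
  have k1 := key _ _ (by positivity) h1
  have k2 := key _ _ (by positivity) h2
  rw [sub_eq_add_neg, EReal.coe_add]
  refine add_le_add k1 ?_
  unfold erealInt
  rw [sub_eq_add_neg, ← zero_add (((-(C + D * m) : ℝ)) : EReal)]
  exact add_le_add (EReal.coe_ennreal_nonneg _) k2
end

section
/- Jensen inequality for mollification of a possibly singular measure: let E : [0,∞) → ℝ be convex, nonincreasing, with E(0) = 0, let ρ be a finite nonnegative Borel measure on ℝ with Lebesgue decomposition ρ = u·ℒ¹ + ρ⊥, and let k : ℝ → [0,∞) be a Borel function with ∫_ℝ k(x) dx = 1. Then ∫_ℝ E((k∗ρ)(x)) dx ≤ ∫_ℝ E(u(x)) dx, where (k∗ρ)(x) := ∫_ℝ k(x−y) dρ(y) and both integrals take values in [−∞, 0]. -/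
open MeasureTheory Set Filter Topology
open scoped ENNReal

theorem support_line
    (E : ℝ → ℝ) (hEconv : ConvexOn ℝ (Set.Ici 0) E) (hEanti : AntitoneOn E (Set.Ici 0))
    (hE0 : E 0 = 0) (m : ℝ) (hm : 0 < m) :
    ∃ a c : ℝ, 0 ≤ a ∧ 0 ≤ c ∧ (∀ t, 0 ≤ t → -E t ≤ a + c * t) ∧ a + c * m = -E m := by
  have hmi : m ∈ interior (Set.Ici (0:ℝ)) := by simpa using hm
  have key : ∀ t, 0 ≤ t → E m + derivWithin E (Ioi m) m * (t - m) ≤ E t := by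
    intro t ht
    rcases lt_trichotomy m t with h | h | h
    · have h1 := hEconv.rightDeriv_le_slope_of_mem_interior hmi ht h
      rw [slope_def_field, le_div_iff₀ (by linarith)] at h1
      linarith
    · subst h; simp
    · have h1 := (hEconv.slope_le_leftDeriv_of_mem_interior ht hmi h).trans
        (hEconv.leftDeriv_le_rightDeriv_of_mem_interior hmi)
      rw [slope_def_field, div_le_iff₀ (by linarith)] at h1
      linarith
  refine ⟨-E m + derivWithin E (Ioi m) m * m, -derivWithin E (Ioi m) m, ?_, ?_, ?_, by ring⟩
  · have := key 0 le_rfl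
    rw [hE0] at this
    linarith
  · have h1 := key (m + 1) (by linarith)
    have h2 := hEanti (show m ∈ Set.Ici (0:ℝ) from hm.le)
      (show m + 1 ∈ Set.Ici (0:ℝ) by simp; linarith) (by linarith)
    linarith
  · intro t ht
    have := key t ht
    linarith

/-- Jensen inequality for mollification of a possibly singular measure:
for `E` convex, nonincreasing on `[0,∞)` with `E(0) = 0` (so `E ≤ 0` there),
a finite nonnegative Borel measure `ρ = u·ℒ¹ + ρ⊥` and a nonnegative Borel kernel `k`
of unit integral, one has `∫ E((k∗ρ)(x)) dx ≤ ∫ E(u(x)) dx`, both integrals taking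
values in `[-∞,0]` (encoded via the Lebesgue integrals of the nonnegative functions
`-E∘(k∗ρ)` and `-E∘u`). -/
theorem jensen_mollification
    (E : ℝ → ℝ) (hEconv : ConvexOn ℝ (Set.Ici 0) E) (hEanti : AntitoneOn E (Set.Ici 0))
    (hE0 : E 0 = 0)
    (ρ : Measure ℝ) (hρ : IsFiniteMeasure ρ)
    (k : ℝ → ℝ) (hk : Measurable k) (hknn : ∀ x : ℝ, 0 ≤ k x)
    (hk1 : (∫ x : ℝ, k x) = 1) :
    (∫⁻ x, ENNReal.ofReal (-(E ((ρ.rnDeriv volume x).toReal))))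
      ≤ ∫⁻ x, ENNReal.ofReal (-(E (∫ y, k (x - y) ∂ρ))) := by
  set K : ℝ → ℝ≥0∞ := fun x => ENNReal.ofReal (k x) with hK
  have hKm : Measurable K := hk.ennreal_ofReal
  have hkint : Integrable k := by
    by_contra h
    rw [integral_undef h] at hk1
    exact zero_ne_one hk1
  have hK1 : ∫⁻ x, K x = 1 := by
    rw [hK, ← ofReal_integral_eq_lintegral_ofReal hkint (Eventually.of_forall hknn), hk1]
    simp
  set u : ℝ → ℝ≥0∞ := ρ.rnDeriv volume with hu
  have hum : Measurable u := Measure.measurable_rnDeriv _ _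
  set G : ℝ → ℝ≥0∞ := fun y => ENNReal.ofReal (-(E ((u y).toReal))) with hG
  have hGm : Measurable G := by
    have hanti : Antitone (fun t : ℝ => E (max t 0)) := by
      intro s t hst
      exact hEanti (le_max_right s 0) (le_max_right t 0) (max_le_max_right 0 hst)
    have h1 : Measurable (fun y => E (max (u y).toReal 0)) :=
      hanti.measurable.comp hum.ennreal_toReal
    have h2 : (fun y => E (max (u y).toReal 0)) = fun y => E ((u y).toReal) := by
      funext y
      rw [max_eq_left ENNReal.toReal_nonneg]
    rw [h2] at h1
    exact h1.neg.ennreal_ofReal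
  have hKm2 : Measurable (fun p : ℝ × ℝ => K (p.1 - p.2)) :=
    hKm.comp (measurable_fst.sub measurable_snd)
  have hKx : ∀ x, Measurable (fun y => K (x - y)) := fun x =>
    hKm.comp (measurable_const.sub measurable_id)
  have hKy : ∀ y, Measurable (fun x => K (x - y)) := fun y =>
    hKm.comp (measurable_id.sub measurable_const)
  have hKu : ∀ x, Measurable (fun y => K (x - y) * u y) := fun x => (hKx x).mul hum
  have hKG : ∀ x, Measurable (fun y => K (x - y) * G y) := fun x => (hKx x).mul hGm
  have hleft : ∫⁻ x, G x = ∫⁻ x, ∫⁻ y, K (x - y) * G y := by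
    rw [lintegral_lintegral_swap (hKm2.mul (hGm.comp measurable_snd)).aemeasurable]
    refine lintegral_congr fun y => ?_
    rw [lintegral_mul_const _ (hKy y),
      lintegral_sub_right_eq_self K y, hK1, one_mul]
  have hfin : ∀ᵐ x : ℝ, ∫⁻ y, K (x - y) ∂ρ < ∞ := by
    refine ae_lt_top (Measurable.lintegral_prod_right' hKm2) ?_
    rw [lintegral_lintegral_swap hKm2.aemeasurable]
    simp_rw [lintegral_sub_right_eq_self K, hK1]
    simp
  rw [hleft]
  refine lintegral_mono_ae ?_
  filter_upwards [hfin] with x hx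
  have hint : ∫ y, k (x - y) ∂ρ = (∫⁻ y, K (x - y) ∂ρ).toReal :=
    integral_eq_lintegral_of_nonneg_ae (Eventually.of_forall fun y => hknn _)
      (hk.comp (measurable_const.sub measurable_id)).aestronglyMeasurable
  rw [hint]
  set M := ∫⁻ y, K (x - y) ∂ρ with hM
  have hule : ∫⁻ y, K (x - y) * u y ≤ M := by
    have h1 : ∫⁻ y, K (x - y) ∂(volume.withDensity u) ≤ M :=
      lintegral_mono' (Measure.withDensity_rnDeriv_le ρ volume) le_rfl
    rw [lintegral_withDensity_eq_lintegral_mul _ hum (hKx x)] at h1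
    simpa [mul_comm] using h1
  have hKx1 : ∫⁻ y, K (x - y) = 1 := by
    rw [lintegral_sub_left_eq_self K x, hK1]
  rcases eq_or_ne M 0 with h0 | h0
  · have h1 : ∫⁻ y, K (x - y) * u y = 0 := le_antisymm (h0 ▸ hule) bot_le
    rw [lintegral_eq_zero_iff (hKu x)] at h1
    have h2 : ∫⁻ y, K (x - y) * G y = 0 := by
      rw [lintegral_eq_zero_iff (hKG x)]
      filter_upwards [h1] with y hy
      rcases mul_eq_zero.1 hy with h | h
      · simp [h]
      · simp [hG, h, hE0]
    rw [h2]
    exact bot_le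
  · obtain ⟨a, c, ha, hc, hle, heq⟩ := support_line E hEconv hEanti hE0 M.toReal
      (ENNReal.toReal_pos h0 hx.ne)
    have hGle : ∀ y, G y ≤ ENNReal.ofReal a + ENNReal.ofReal c * u y := by
      intro y
      calc G y ≤ ENNReal.ofReal (a + c * (u y).toReal) :=
            ENNReal.ofReal_le_ofReal (hle _ ENNReal.toReal_nonneg)
        _ = ENNReal.ofReal a + ENNReal.ofReal c * ENNReal.ofReal (u y).toReal := by
            rw [ENNReal.ofReal_add ha (mul_nonneg hc ENNReal.toReal_nonneg),
              ENNReal.ofReal_mul hc]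
        _ ≤ _ := by gcongr; exact ENNReal.ofReal_toReal_le
    calc ∫⁻ y, K (x - y) * G y
        ≤ ∫⁻ y, (ENNReal.ofReal a * K (x - y) + ENNReal.ofReal c * (K (x - y) * u y)) := by
          refine lintegral_mono fun y => ?_
          calc K (x - y) * G y ≤ K (x - y) * (ENNReal.ofReal a + ENNReal.ofReal c * u y) := by
                gcongr; exact hGle y
            _ = _ := by ring
      _ = ENNReal.ofReal a + ENNReal.ofReal c * ∫⁻ y, K (x - y) * u y := by
          rw [lintegral_add_left ((hKx x).const_mul _), lintegral_const_mul _ (hKx x),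
            lintegral_const_mul _ (hKu x), hKx1, mul_one]
      _ ≤ ENNReal.ofReal a + ENNReal.ofReal c * M := by gcongr
      _ = ENNReal.ofReal (-E M.toReal) := by
          rw [← heq, ENNReal.ofReal_add ha (mul_nonneg hc ENNReal.toReal_nonneg),
              ENNReal.ofReal_mul hc, ENNReal.ofReal_toReal hx.ne]
end

section
/- The negative derivative of the energy density is a decreasing homeomorphism onto (0, 𝔡): the map r ↦ −E'(r) = ∫_r^∞ (β'(s)/s) ds is continuous and strictly decreasing on (0,∞), satisfies lim_{r→∞}(−E'(r)) = 0 and lim_{r→0⁺}(−E'(r)) = 𝔡, and hence maps (0,∞) bijectively onto the set {v ∈ ℝ : 0 < v < 𝔡} (equal to (0,∞) when 𝔡 = +∞). -/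
open MeasureTheory Set Filter Topology
open scoped ENNReal

/-- the map `r ↦ -E'(r) = ∫_r^∞ β'(s)/s ds` is continuous and strictly
decreasing on `(0,∞)`, tends to `0` at `+∞` and to `𝔡` at `0⁺`, and maps `(0,∞)`
bijectively onto `{v | 0 < v < 𝔡}`. -/
theorem negEprime_decreasing_homeomorphism
    (β : ℝ → ℝ) (βinf : ℝ)
    (hβ : ContDiff ℝ 1 β) (hβmono : StrictMonoOn β (Set.Ici 0)) (hβ0 : β 0 = 0)
    (hβlim : Tendsto β atTop (𝓝 βinf)) :
    StrictAntiOn (fun r : ℝ => ∫ s in Set.Ioi r, deriv β s / s) (Set.Ioi 0) ∧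
      ContinuousOn (fun r : ℝ => ∫ s in Set.Ioi r, deriv β s / s) (Set.Ioi 0) ∧
      Tendsto (fun r : ℝ => ∫ s in Set.Ioi r, deriv β s / s) atTop (𝓝 0) ∧
      Tendsto (fun r : ℝ => ENNReal.ofReal (∫ s in Set.Ioi r, deriv β s / s))
        (𝓝[>] (0 : ℝ)) (𝓝 (dcrit β)) ∧
      Set.BijOn (fun r : ℝ => ∫ s in Set.Ioi r, deriv β s / s) (Set.Ioi 0)
        {v : ℝ | 0 < v ∧ ENNReal.ofReal v < dcrit β} := by
  have hcont : Continuous (deriv β) := hβ.continuous_deriv le_rfl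
  have hdiff : Differentiable ℝ β := hβ.differentiable one_ne_zero
  have hnn : ∀ s : ℝ, 0 < s → 0 ≤ deriv β s := by
    intro s hs
    have h := hβmono.monotoneOn.derivWithin_nonneg (x := s)
    rwa [derivWithin_of_mem_nhds (Ici_mem_nhds hs)] at h
  have hfnn : ∀ s : ℝ, 0 < s → 0 ≤ deriv β s / s := fun s hs => div_nonneg (hnn s hs) hs.le
  have hmeas : Measurable (fun s : ℝ => deriv β s / s) := hcont.measurable.div measurable_id
  have hint : ∀ r : ℝ, 0 < r → IntegrableOn (fun s : ℝ => deriv β s / s) (Ioi r) := by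
    intro r hr
    have h1 : IntegrableOn (deriv β) (Ioi r) :=
      integrableOn_Ioi_deriv_of_nonneg' (fun x _ => (hdiff x).hasDerivAt)
        (fun x hx => hnn x (hr.trans hx)) hβlim
    refine Integrable.mono' (Integrable.div_const h1 r) hmeas.aestronglyMeasurable ?_
    filter_upwards [ae_restrict_mem measurableSet_Ioi] with s hs
    have hs' : r < s := hs
    rw [Real.norm_of_nonneg (hfnn s (hr.trans hs'))]
    exact div_le_div_of_nonneg_left (hnn s (hr.trans hs')) hr hs'.le
  have hanti : StrictAntiOn (fun r : ℝ => ∫ s in Set.Ioi r, deriv β s / s) (Set.Ioi 0) := by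
    intro a ha b hb hab
    have ha' : 0 < a := ha
    have hb' : 0 < b := hb
    have h1 := intervalIntegral.integral_Ioi_sub_Ioi (hint a ha) hab.le
    have h2 : ∫ s in a..b, deriv β s / b ≤ ∫ s in a..b, deriv β s / s := by
      refine intervalIntegral.integral_mono_on hab.le
        ((hcont.div_const b).intervalIntegrable a b) ?_ ?_
      · rw [intervalIntegrable_iff_integrableOn_Ioc_of_le hab.le]
        exact (hint a ha).mono_set Ioc_subset_Ioi_self
      · intro s hs
        have hs0 : 0 < s := ha'.trans_le hs.1
        exact div_le_div_of_nonneg_left (hnn s hs0) hs0 hs.2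
    have h3 : ∫ s in a..b, deriv β s / b = (β b - β a) / b := by
      rw [intervalIntegral.integral_div, intervalIntegral.integral_deriv_eq_sub
        (fun x _ => hdiff x) (hcont.intervalIntegrable a b)]
    have h4 : 0 < (β b - β a) / b :=
      div_pos (sub_pos.2 (hβmono ha'.le hb'.le hab)) hb'
    show (∫ s in Set.Ioi b, deriv β s / s) < ∫ s in Set.Ioi a, deriv β s / s
    linarith
  have hcts : ContinuousOn (fun r : ℝ => ∫ s in Set.Ioi r, deriv β s / s) (Set.Ioi 0) := by
    intro r hr
    have hr' : 0 < r := hr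
    have h := (hint (r / 2) (half_pos hr')).continuousOn_Ici_primitive_Ioi
    exact (h.continuousAt (Ici_mem_nhds (half_lt_self hr'))).continuousWithinAt
  have htop : Tendsto (fun r : ℝ => ∫ s in Set.Ioi r, deriv β s / s) atTop (𝓝 0) := by
    have h := intervalIntegral_tendsto_integral_Ioi 1 (hint 1 one_pos) tendsto_id
    have h2 := h.const_sub (∫ s in Set.Ioi (1 : ℝ), deriv β s / s)
    rw [sub_self] at h2
    refine h2.congr' ?_
    filter_upwards [eventually_ge_atTop (1 : ℝ)] with r hr
    have := intervalIntegral.integral_Ioi_sub_Ioi (hint 1 one_pos) hr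
    simp only [id]
    linarith
  have heq : ∀ r : ℝ, 0 < r → ENNReal.ofReal (∫ s in Set.Ioi r, deriv β s / s)
      = ∫⁻ s in Set.Ioi r, ENNReal.ofReal (deriv β s / s) := by
    intro r hr
    refine ofReal_integral_eq_lintegral_ofReal (hint r hr) ?_
    filter_upwards [ae_restrict_mem measurableSet_Ioi] with s hs
    exact hfnn s (hr.trans hs)
  have hzero : Tendsto (fun r : ℝ => ENNReal.ofReal (∫ s in Set.Ioi r, deriv β s / s))
        (𝓝[>] (0 : ℝ)) (𝓝 (dcrit β)) := by
    have hc : AECover ((volume : Measure ℝ).restrict (Ioi 0)) (𝓝[>] (0 : ℝ))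
        (fun r : ℝ => Ioi r) :=
      aecover_Ioi_of_Ioi (tendsto_id.mono_left nhdsWithin_le_nhds)
    have h := hc.lintegral_tendsto_of_countably_generated
      (f := fun s => ENNReal.ofReal (deriv β s / s)) hmeas.ennreal_ofReal.aemeasurable
    refine h.congr' ?_
    filter_upwards [self_mem_nhdsWithin] with r hr
    have hr' : 0 < r := hr
    rw [heq r hr', Measure.restrict_restrict measurableSet_Ioi,
      inter_eq_left.2 (Ioi_subset_Ioi hr'.le)]
  have hF0 : ∀ r : ℝ, 0 < r → 0 ≤ ∫ s in Set.Ioi r, deriv β s / s := fun r hr =>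
    setIntegral_nonneg measurableSet_Ioi fun s hs => hfnn s (hr.trans hs)
  have hFpos : ∀ r : ℝ, 0 < r → 0 < ∫ s in Set.Ioi r, deriv β s / s := fun r hr =>
    (hF0 (r + 1) (by linarith)).trans_lt
      (hanti (show (0 : ℝ) < r from hr) (show (0 : ℝ) < r + 1 by linarith) (by linarith))
  refine ⟨hanti, hcts, htop, hzero, ?_, hanti.injOn, ?_⟩
  · intro r hr
    have hr' : 0 < r := hr
    refine ⟨hFpos r hr', ?_⟩
    have h1 : (∫ s in Set.Ioi r, deriv β s / s) < ∫ s in Set.Ioi (r / 2), deriv β s / s :=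
      hanti (show (0 : ℝ) < r / 2 from half_pos hr') hr (half_lt_self hr')
    calc ENNReal.ofReal (∫ s in Set.Ioi r, deriv β s / s)
        < ENNReal.ofReal (∫ s in Set.Ioi (r / 2), deriv β s / s) :=
          (ENNReal.ofReal_lt_ofReal_iff (hFpos _ (half_pos hr'))).2 h1
      _ = ∫⁻ s in Set.Ioi (r / 2), ENNReal.ofReal (deriv β s / s) := heq _ (half_pos hr')
      _ ≤ dcrit β := lintegral_mono_set (Ioi_subset_Ioi (half_pos hr').le)
  · rintro v ⟨hv, hvd⟩
    obtain ⟨a, hav, ha⟩ := ((hzero.eventually_const_lt hvd).and self_mem_nhdsWithin).exists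
    obtain ⟨b, hbv, hb⟩ := ((htop.eventually_lt_const hv).and (eventually_gt_atTop 0)).exists
    have hav' := (ENNReal.ofReal_lt_ofReal_iff_of_nonneg hv.le).1 hav
    exact isPreconnected_Ioi.intermediate_value hb ha hcts ⟨hbv.le, hav'.le⟩
end

section
/- Existence of a finite critical mass in ℝᵈ: for α > 0 and d ≥ 1, the function x ↦ (e^{α|x|²/2} − 1)^{−1/α} on ℝᵈ∖{0} is Lebesgue integrable if and only if α > 2/d. -/
open MeasureTheory Set Filter Topology

lemma cm_key (d : ℕ) (hd : 1 ≤ d) (α : ℝ) (hα : 0 < α) (k y : ℝ) (hy : 0 < y) :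
    y ^ (d - 1) * ((α * y ^ 2 / 2) * Real.exp (k * (α * y ^ 2 / 2))) ^ (-(1 / α))
      = (α / 2) ^ (-(1 / α)) * (y ^ ((d : ℝ) - 1 - 2 / α) * Real.exp (-(k / 2) * y ^ 2)) := by
  have h1 : α * y ^ 2 / 2 = (α / 2) * y ^ 2 := by ring
  have h2 : y ^ ((d : ℝ) - 1 - 2 / α) = y ^ (d - 1) * (y ^ 2) ^ (-(1 / α)) := by
    rw [← Real.rpow_natCast y 2, ← Real.rpow_mul hy.le, ← Real.rpow_natCast y (d - 1),
      ← Real.rpow_add hy]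
    congr 1
    push_cast [Nat.cast_sub hd]
    ring
  have h3 : (Real.exp (k * (α * y ^ 2 / 2))) ^ (-(1 / α)) = Real.exp (-(k / 2) * y ^ 2) := by
    rw [← Real.exp_mul]
    congr 1
    field_simp
  rw [Real.mul_rpow (by positivity) (by positivity), h3, h1,
    Real.mul_rpow (by positivity) (by positivity), h2]
  ring

lemma cm_lower (u : ℝ) (hu : 0 ≤ u) : u * Real.exp (1 / 2 * u) ≤ Real.exp u - 1 := by
  have h := Real.self_le_sinh_iff.2 (by linarith : 0 ≤ u / 2)
  rw [Real.sinh_eq] at h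
  have e1 : Real.exp u = Real.exp (u / 2) * Real.exp (u / 2) := by
    rw [← Real.exp_add]; ring_nf
  have e2 : Real.exp (u / 2) * Real.exp (-(u / 2)) = 1 := by
    rw [← Real.exp_add]; simp
  have e3 : 1 / 2 * u = u / 2 := by ring
  rw [e3, e1]
  nlinarith [Real.exp_pos (u / 2)]

lemma cm_upper (u : ℝ) : Real.exp u - 1 ≤ u * Real.exp (1 * u) := by
  have h := Real.add_one_le_exp (-u)
  have e2 : Real.exp u * Real.exp (-u) = 1 := by
    rw [← Real.exp_add]; simp
  rw [one_mul]
  nlinarith [Real.exp_pos u]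

/-- existence of a finite critical mass in `ℝᵈ`: the generalized
Bose–Einstein profile `x ↦ (e^{α|x|²/2} - 1)^{-1/α}` is Lebesgue integrable on
`ℝᵈ∖{0}` if and only if `α > 2/d`. -/
theorem critical_mass_finite_iff
    (d : ℕ) (hd : 1 ≤ d) (α : ℝ) (hα : 0 < α) :
    MeasureTheory.IntegrableOn
        (fun x : EuclideanSpace ℝ (Fin d) =>
          ((Real.exp (α * ‖x‖ ^ 2 / 2) - 1) ^ (-(1 / α)) : ℝ))
        {(0 : EuclideanSpace ℝ (Fin d))}ᶜ volume
      ↔ 2 / (d : ℝ) < α := by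
  have hne : Nonempty (Fin d) := ⟨⟨0, hd⟩⟩
  have hdpos : (0 : ℝ) < d := by exact_mod_cast hd
  have hexp : 2 / (d : ℝ) < α ↔ -1 < (d : ℝ) - 1 - 2 / α := by
    rw [div_lt_comm₀ hdpos hα]
    constructor <;> intro h <;> linarith
  have hneg : -(1 / α) ≤ 0 := by
    have : 0 < 1 / α := by positivity
    linarith
  rw [IntegrableOn, restrict_compl_singleton,
    integrable_fun_norm_addHaar volume
      (f := fun y : ℝ => (Real.exp (α * y ^ 2 / 2) - 1) ^ (-(1 / α))),
    finrank_euclideanSpace_fin, hexp]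
  simp only [smul_eq_mul]
  have hc : 0 < (α / 2) ^ (-(1 / α)) := by positivity
  constructor
  · intro h
    rw [← intervalIntegral.integrableOn_Ioo_rpow_iff (zero_lt_one)]
    have h' := (h.mono_set (Ioo_subset_Ioi_self : Ioo (0 : ℝ) 1 ⊆ Ioi 0)).const_mul
      (((α / 2) ^ (-(1 / α)))⁻¹ * Real.exp (1 / 2))
    refine Integrable.mono' h' (by fun_prop) ?_
    refine (ae_restrict_iff' measurableSet_Ioo).2 (.of_forall fun y hy => ?_)
    have hy0 : 0 < y := hy.1
    rw [Real.norm_of_nonneg (by positivity)]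
    have hu : 0 < α * y ^ 2 / 2 := by positivity
    have hpos : 0 < Real.exp (α * y ^ 2 / 2) - 1 := by
      have := Real.add_one_le_exp (α * y ^ 2 / 2)
      linarith
    have hb := Real.rpow_le_rpow_of_nonpos hpos (cm_upper (α * y ^ 2 / 2)) hneg
    have hb2 := mul_le_mul_of_nonneg_left hb (by positivity : 0 ≤ y ^ (d - 1))
    rw [cm_key d hd α hα 1 y hy0] at hb2
    have he : 1 ≤ Real.exp (1 / 2) * Real.exp (-(1 / 2) * y ^ 2) := by
      rw [← Real.exp_add]
      apply Real.one_le_exp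
      nlinarith [hy.2]
    calc y ^ ((d : ℝ) - 1 - 2 / α)
        ≤ y ^ ((d : ℝ) - 1 - 2 / α) * (Real.exp (1 / 2) * Real.exp (-(1 / 2) * y ^ 2)) :=
          le_mul_of_one_le_right (by positivity) he
      _ = (((α / 2) ^ (-(1 / α)))⁻¹ * Real.exp (1 / 2)) * ((α / 2) ^ (-(1 / α)) *
            (y ^ ((d : ℝ) - 1 - 2 / α) * Real.exp (-(1 / 2) * y ^ 2))) := by
          generalize (α / 2) ^ (-(1 / α)) = c at hc
          field_simp
      _ ≤ _ := mul_le_mul_of_nonneg_left hb2 (by positivity)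
  · intro h
    have h' := (integrableOn_rpow_mul_exp_neg_mul_sq (b := 1 / 2 / 2) (by norm_num) h).const_mul
      ((α / 2) ^ (-(1 / α)))
    refine Integrable.mono' h' (Measurable.aestronglyMeasurable (by fun_prop)) ?_
    refine (ae_restrict_iff' measurableSet_Ioi).2 (.of_forall fun y hy => ?_)
    have hy0 : 0 < y := hy
    have hu : 0 < α * y ^ 2 / 2 := by positivity
    have hpos : 0 < Real.exp (α * y ^ 2 / 2) - 1 := by
      have := Real.add_one_le_exp (α * y ^ 2 / 2)
      linarith
    rw [Real.norm_of_nonneg (by positivity)]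
    have hb := Real.rpow_le_rpow_of_nonpos (by positivity) (cm_lower (α * y ^ 2 / 2) hu.le) hneg
    have hb2 := mul_le_mul_of_nonneg_left hb (by positivity : 0 ≤ y ^ (d - 1))
    rwa [cm_key d hd α hα (1 / 2) y hy0] at hb2
end

section
/- Criticality threshold in Example 1: for α > 0, the function x ↦ e^{−|x|^α}/√(1 − e^{−2|x|^α}) on ℝ∖{0} is Lebesgue integrable if and only if α < 2. -/
open MeasureTheory Set Filter Topology

lemma aux_pow (x α : ℝ) (hx : 0 < x) : x ^ (-(α/2)) = 1 / Real.sqrt (x ^ α) := by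
  rw [Real.rpow_neg hx.le, Real.sqrt_eq_rpow, ← Real.rpow_mul hx.le, one_div]
  congr 2; ring

lemma aux_upper (u : ℝ) (hu : 0 < u) :
    Real.exp (-u) / Real.sqrt (1 - Real.exp (-2 * u)) ≤
      1 / Real.sqrt u * Real.exp (-(1/2) * u) := by
  have h2 : Real.exp (-2 * u) = Real.exp (-u) * Real.exp (-u) := by
    rw [← Real.exp_add]; ring_nf
  have h3 : Real.exp (-u) = Real.exp (-(1/2) * u) * Real.exp (-(1/2) * u) := by
    rw [← Real.exp_add]; ring_nf
  have h1 : u * Real.exp (-u) ≤ 1 - Real.exp (-u) := by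
    have := Real.add_one_le_exp u
    have h4 : Real.exp u * Real.exp (-u) = 1 := by rw [← Real.exp_add]; simp
    nlinarith [Real.exp_pos (-u)]
  have h5 : Real.exp (-u) ≤ 1 := Real.exp_le_one_iff.2 (by linarith)
  have h6 : Real.sqrt u * Real.exp (-(1/2) * u) ≤ Real.sqrt (1 - Real.exp (-2 * u)) := by
    apply Real.le_sqrt_of_sq_le
    rw [mul_pow, Real.sq_sqrt hu.le, sq, ← h3, h2]
    nlinarith [Real.exp_pos (-u)]
  have hs := Real.sqrt_pos.2 hu
  have he := Real.exp_pos (-(1/2) * u)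
  calc _ ≤ Real.exp (-u) / (Real.sqrt u * Real.exp (-(1/2) * u)) := by gcongr
    _ = _ := by rw [h3]; field_simp

lemma aux_lower (u : ℝ) (hu : 0 < u) (hu1 : u ≤ 1) :
    1 / Real.sqrt u ≤ (Real.exp 1 * Real.sqrt 2) *
      (Real.exp (-u) / Real.sqrt (1 - Real.exp (-2 * u))) := by
  have h1 : 1 - Real.exp (-2 * u) ≤ 2 * u := by linarith [Real.add_one_le_exp (-2 * u)]
  have h0 : 0 < 1 - Real.exp (-2 * u) := by
    have : Real.exp (-2 * u) < 1 := Real.exp_lt_one_iff.2 (by linarith)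
    linarith
  have h2 : Real.sqrt (1 - Real.exp (-2 * u)) ≤ Real.sqrt 2 * Real.sqrt u := by
    rw [← Real.sqrt_mul (by norm_num)]; exact Real.sqrt_le_sqrt h1
  have h3 : 1 ≤ Real.exp 1 * Real.exp (-u) := by
    rw [← Real.exp_add]; exact Real.one_le_exp (by linarith)
  have hs := Real.sqrt_pos.2 hu
  have hs0 := Real.sqrt_pos.2 h0
  have : 0 < Real.sqrt 2 := by positivity
  rw [← mul_div_assoc, div_le_div_iff₀ hs hs0]
  nlinarith [mul_le_mul_of_nonneg_right h3 (by positivity : 0 ≤ Real.sqrt 2 * Real.sqrt u)]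

/-- criticality threshold in Example 1: for `α > 0`, the function
`x ↦ e^{-|x|^α}/√(1-e^{-2|x|^α})` is Lebesgue integrable on `ℝ∖{0}` iff `α < 2`. -/
theorem arctan_example_critical_mass_iff
    (α : ℝ) (hα : 0 < α) :
    MeasureTheory.IntegrableOn
        (fun x : ℝ => Real.exp (-(|x| ^ α)) / Real.sqrt (1 - Real.exp (-2 * |x| ^ α)))
        {(0 : ℝ)}ᶜ volume
      ↔ α < 2 := by
  have hm : Measurable
      (fun x : ℝ => Real.exp (-(|x| ^ α)) / Real.sqrt (1 - Real.exp (-2 * |x| ^ α))) := by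
    fun_prop
  constructor
  · intro h
    have h1 := (h.mono_set (s := Ioo (0:ℝ) 1) (fun x hx => hx.1.ne')).const_mul
      (Real.exp 1 * Real.sqrt 2)
    have h2 : IntegrableOn (fun x : ℝ => x ^ (-(α/2))) (Ioo (0:ℝ) 1) := by
      refine Integrable.mono' h1 (by fun_prop) ?_
      refine (ae_restrict_iff' measurableSet_Ioo).2 (Eventually.of_forall fun x hx => ?_)
      rw [Real.norm_of_nonneg (Real.rpow_nonneg hx.1.le _), aux_pow x α hx.1, abs_of_pos hx.1]
      exact aux_lower _ (Real.rpow_pos_of_pos hx.1 _) (Real.rpow_le_one hx.1.le hx.2.le hα.le)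
    rw [intervalIntegral.integrableOn_Ioo_rpow_iff one_pos] at h2
    linarith
  · intro h
    have h1 : IntegrableOn (fun x : ℝ => x ^ (-(α/2)) * Real.exp (-(1/2) * x ^ α)) (Ioi 0) :=
      integrableOn_rpow_mul_exp_neg_mul_rpow (by linarith) hα (by norm_num)
    have h2 : IntegrableOn
        (fun x : ℝ => Real.exp (-(|x| ^ α)) / Real.sqrt (1 - Real.exp (-2 * |x| ^ α)))
        (Ioi 0) := by
      refine Integrable.mono' h1 hm.aestronglyMeasurable ?_
      refine (ae_restrict_iff' measurableSet_Ioi).2 (Eventually.of_forall fun x hx => ?_)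
      have hx : 0 < x := hx
      rw [Real.norm_of_nonneg (by positivity), aux_pow x α hx, abs_of_pos hx]
      exact aux_upper _ (Real.rpow_pos_of_pos hx _)
    have h3 : IntegrableOn
        (fun x : ℝ => Real.exp (-(|x| ^ α)) / Real.sqrt (1 - Real.exp (-2 * |x| ^ α)))
        (Iio 0) := by
      have := (Measure.measurePreserving_neg (volume : Measure ℝ)).integrableOn_comp_preimage
        (Homeomorph.neg ℝ).measurableEmbedding |>.2 h2
      simpa [Function.comp_def] using this
    rw [← Iio_union_Ioi]
    exact h3.union h2
end
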